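/- arXiv:1305.3000 — 3 statements merged into one kernel-verified Lean document; each statement's English description precedes it below -/
import Mathlib

section
/- If A₁, ..., A_k are symmetric n×n matrices each with eigenvalues in Γₖ⁺, then the polarized symmetric function satisfies Σ_k(A₁,...,A_k) > 0. -/
/-- The `k`-th elementary symmetric polynomial of `lam : Fin n → ℝ`. -/
noncomputable def esymm (n k : ℕ) (lam : Fin n → ℝ) : ℝ :=
  ∑ s ∈ Finset.powersetCard k (Finset.univ : Finset (Fin n)), ∏ i ∈ s, lam i

/-- Membership in the Garding cone `Γₖ⁺`: all `σⱼ > 0` for `1 ≤ j ≤ k`. -/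
def inGamma (n k : ℕ) (lam : Fin n → ℝ) : Prop :=
  ∀ j : ℕ, 1 ≤ j → j ≤ k → 0 < esymm n j lam

/-- The generalized Kronecker delta `δ^{i₁...iₖ}_{j₁...jₖ}`:
the determinant of the matrix of ordinary Kronecker deltas. -/
noncomputable def gkdelta {k n : ℕ} (i j : Fin k → Fin n) : ℝ :=
  Matrix.det (Matrix.of fun a b : Fin k => if i a = j b then (1 : ℝ) else 0)

/-- The polarization `Σ_k(A₁,...,A_k) = (1/(k-1)!) δ^{i₁...iₖ}_{j₁...jₖ}
(A₁)_{i₁j₁}⋯(A_k)_{iₖjₖ}` of the `k`-th elementary symmetric function. -/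
noncomputable def polSigma (n k : ℕ) (A : Fin k → Matrix (Fin n) (Fin n) ℝ) : ℝ :=
  (1 / (Nat.factorial (k - 1) : ℝ)) *
    ∑ i : Fin k → Fin n, ∑ j : Fin k → Fin n,
      gkdelta i j * ∏ a : Fin k, A a (i a) (j a)

/-- The polarized Newton transformation tensor
`[Tₖ]_{pq}(A₁,...,Aₖ) = (1/k!) δ^{p,i₁,...,iₖ}_{q,j₁,...,jₖ} (A₁)_{i₁j₁}⋯(Aₖ)_{iₖjₖ}`. -/
noncomputable def polNewton (n k : ℕ) (A : Fin k → Matrix (Fin n) (Fin n) ℝ) :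
    Matrix (Fin n) (Fin n) ℝ :=
  Matrix.of fun p q : Fin n =>
    (1 / (Nat.factorial k : ℝ)) *
      ∑ i : Fin k → Fin n, ∑ j : Fin k → Fin n,
        gkdelta (Fin.cons p i) (Fin.cons q j) * ∏ a : Fin k, A a (i a) (j a)


open Polynomial in
theorem poly_lower (Q : Polynomial ℂ) (m : ℕ) (hd : Q.natDegree ≤ m) (hm : Q.coeff m ≠ 0)
    (hr : ∀ s : ℂ, 0 ≤ s.re → Q.eval s ≠ 0) (s : ℂ) (hs : 0 ≤ s.re) :
    ‖Q.coeff m‖ * s.re ^ m ≤ ‖Q.eval s‖ := by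
  have hdeg : Q.natDegree = m := le_antisymm hd (Polynomial.le_natDegree_of_ne_zero hm)
  have hsp : Q.Splits := IsAlgClosed.splits Q
  have hcard := hsp.natDegree_eq_card_roots
  have hlc : Q.leadingCoeff = Q.coeff m := by rw [Polynomial.leadingCoeff, hdeg]
  have hQ0 : Q ≠ 0 := by rintro rfl; simp at hm
  have hroots : ∀ r ∈ Q.roots, r.re < 0 := by
    intro r h
    by_contra hh
    exact hr r (not_lt.mp hh) ((Polynomial.mem_roots hQ0).1 h)
  have key : ∀ M : Multiset ℂ, (∀ r ∈ M, r.re < 0) →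
      s.re ^ (Multiset.card M) ≤ ‖(M.map (fun r => s - r)).prod‖ := by
    intro M
    induction M using Multiset.induction_on with
    | empty => simp
    | cons a M ih =>
      intro h
      have h1 := ih (fun r hr => h r (Multiset.mem_cons_of_mem hr))
      have h2 := h a (Multiset.mem_cons_self a M)
      rw [Multiset.card_cons, Multiset.map_cons, Multiset.prod_cons, norm_mul, pow_succ']
      refine mul_le_mul ?_ h1 (by positivity) (norm_nonneg _)
      calc s.re ≤ (s - a).re := by rw [Complex.sub_re]; linarith
        _ ≤ ‖s - a‖ := Complex.re_le_norm _
  have he : Q.eval s = Q.coeff m * (Q.roots.map (fun r => s - r)).prod := by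
    conv_lhs => rw [hsp.eq_prod_roots]
    rw [eval_mul, eval_C, hlc, eval_multiset_prod, Multiset.map_map]
    simp
  rw [he, norm_mul]
  have := key _ hroots
  rw [← hcard, hdeg] at this
  gcongr

theorem poly_logderiv (Q : Polynomial ℂ) (hd : 0 < Q.natDegree)
    (hr : ∀ s : ℂ, 0 ≤ s.re → Q.eval s ≠ 0) :
    0 < (Q.coeff 1 / Q.coeff 0).re := by
  have hsp : Q.Splits := IsAlgClosed.splits Q
  have hcard := hsp.natDegree_eq_card_roots
  have hQ0 : Q ≠ 0 := by rintro rfl; simp at hd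
  have hroots : ∀ r ∈ Q.roots, r.re < 0 := by
    intro r h
    by_contra hh
    exact hr r (not_lt.mp hh) ((Polynomial.mem_roots hQ0).1 h)
  have h0 := hr 0 (by simp)
  have h := hsp.eval_derivative_div_eval_of_ne_zero h0
  rw [← Polynomial.coeff_zero_eq_eval_zero, ← Polynomial.coeff_zero_eq_eval_zero,
    Polynomial.coeff_derivative] at h
  simp only [zero_add, Nat.cast_zero, mul_one] at h
  rw [h]
  have key : ∀ M : Multiset ℂ, (∀ r ∈ M, r.re < 0) → M ≠ 0 →
      0 < ((M.map (fun z : ℂ => 1 / (0 - z))).sum).re := by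
    have aux : ∀ a : ℂ, a.re < 0 → 0 < (1 / (0 - a)).re := by
      intro a ha
      have : a ≠ 0 := by rintro rfl; simp at ha
      simp only [zero_sub, one_div, Complex.inv_re, Complex.neg_re]
      exact div_pos (by linarith) (Complex.normSq_pos.2 (neg_ne_zero.2 this))
    intro M
    induction M using Multiset.induction_on with
    | empty => simp
    | cons a M ih =>
      intro h _
      have h2 := aux a (h a (Multiset.mem_cons_self a M))
      rw [Multiset.map_cons, Multiset.sum_cons, Complex.add_re]
      by_cases hM : M = 0
      · subst hM; simpa using h2
      · have h1 := ih (fun r hr => h r (Multiset.mem_cons_of_mem hr)) hM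
        linarith
  apply key _ hroots
  intro hc
  rw [hc] at hcard
  simp at hcard
  omega

section multilin
variable {V : Type*} [AddCommGroup V] [Module ℂ V]

/-- The diagonal of a multilinear form. -/
def mdiag {m : ℕ} (F : MultilinearMap ℂ (fun _ : Fin m => V) ℂ) (x : V) : ℂ := F (fun _ => x)

/-- The restriction of the diagonal to a line, as a polynomial. -/
noncomputable def linePoly {m : ℕ} (F : MultilinearMap ℂ (fun _ : Fin m => V) ℂ) (c a : V) :
    Polynomial ℂ :=
  ∑ S : Finset (Fin m), Polynomial.monomial S.card (F (S.piecewise (fun _ => a) (fun _ => c)))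

theorem linePoly_eval {m : ℕ} (F : MultilinearMap ℂ (fun _ : Fin m => V) ℂ) (c a : V) (s : ℂ) :
    (linePoly F c a).eval s = mdiag F (c + s • a) := by
  have h := F.map_add_univ (fun _ => s • a) (fun _ => c)
  have h2 : (fun _ : Fin m => s • a) + (fun _ => c) = fun _ => c + s • a := by
    funext i; simp [add_comm]
  rw [h2] at h
  rw [mdiag, h, linePoly, Polynomial.eval_finset_sum]
  refine Finset.sum_congr rfl fun S _ => ?_
  have h3 := F.map_piecewise_smul (fun _ => s) (S.piecewise (fun _ => a) (fun _ => c)) S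
  rw [Polynomial.eval_monomial]
  have h4 : S.piecewise (fun i => s • (S.piecewise (fun _ => a) (fun _ => c) : Fin m → V) i)
      (S.piecewise (fun _ => a) (fun _ => c)) = S.piecewise (fun _ => s • a) (fun _ => c) := by
    funext i
    by_cases hi : i ∈ S <;> simp [hi]
  rw [h4] at h3
  rw [h3]
  simp [mul_comm]

theorem linePoly_natDegree {m : ℕ} (F : MultilinearMap ℂ (fun _ : Fin m => V) ℂ) (c a : V) :
    (linePoly F c a).natDegree ≤ m := by
  refine Polynomial.natDegree_sum_le_of_forall_le _ _ fun S _ => ?_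
  refine (Polynomial.natDegree_monomial_le _).trans ?_
  simpa using Finset.card_le_univ S

theorem linePoly_coeff_top {m : ℕ} (F : MultilinearMap ℂ (fun _ : Fin m => V) ℂ) (c a : V) :
    (linePoly F c a).coeff m = mdiag F a := by
  rw [linePoly, Polynomial.finset_sum_coeff, Finset.sum_eq_single Finset.univ]
  · simp [Polynomial.coeff_monomial, mdiag]
  · intro S _ hS
    rw [Polynomial.coeff_monomial, if_neg]
    intro h
    exact hS ((Finset.card_eq_iff_eq_univ S).1 (by simpa using h))
  · simp

theorem linePoly_coeff_zero {m : ℕ} (F : MultilinearMap ℂ (fun _ : Fin m => V) ℂ) (c a : V) :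
    (linePoly F c a).coeff 0 = mdiag F c := by
  rw [Polynomial.coeff_zero_eq_eval_zero, linePoly_eval]; simp

/-- Symmetry of a multilinear form. -/
def IsSymmForm {m : ℕ} (F : MultilinearMap ℂ (fun _ : Fin m => V) ℂ) : Prop :=
  ∀ (σ : Equiv.Perm (Fin m)) (v : Fin m → V), F (fun i => v (σ i)) = F v

theorem linePoly_coeff_one {m : ℕ} (F : MultilinearMap ℂ (fun _ : Fin (m + 1) => V) ℂ)
    (hF : IsSymmForm F) (c a : V) :
    (linePoly F c a).coeff 1 = (m + 1 : ℂ) * F (Fin.cons a (fun _ => c)) := by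
  have h1 : (linePoly F c a).coeff 1 = ∑ S ∈ Finset.powersetCard 1 (Finset.univ),
      F (S.piecewise (fun _ => a) (fun _ => c)) := by
    rw [linePoly, Polynomial.finset_sum_coeff]
    simp only [Polynomial.coeff_monomial]
    rw [← Finset.sum_filter]
    refine Finset.sum_congr ?_ fun _ _ => rfl
    ext S; simp
  rw [h1, Finset.powersetCard_one, Finset.sum_map]
  have h2 : ∀ i : Fin (m + 1), F (({i} : Finset (Fin (m + 1))).piecewise (fun _ => a) (fun _ => c))
      = F (Fin.cons a (fun _ => c)) := by
    intro i
    rw [← hF (Equiv.swap i 0)]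
    congr 1
    funext j
    refine Fin.cases ?_ (fun j => ?_) j
    · simp
    · have : Equiv.swap i 0 j.succ ≠ i := by
        intro h
        have := congrArg (Equiv.swap i 0) h
        simp at this
      simp [Finset.piecewise, this]
  simp [h2]

theorem mdiag_smul {m : ℕ} (F : MultilinearMap ℂ (fun _ : Fin m => V) ℂ) (s : ℂ) (x : V) :
    mdiag F (s • x) = s ^ m * mdiag F x := by
  have := F.map_smul_univ (fun _ => s) (fun _ => x)
  simpa [mdiag] using this

theorem mdiag_lower {m : ℕ} (F : MultilinearMap ℂ (fun _ : Fin m => V) ℂ) (c a : V)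
    (ha : mdiag F a ≠ 0) (h : ∀ s : ℂ, 0 ≤ s.re → mdiag F (c + s • a) ≠ 0)
    (s : ℂ) (hs : 0 ≤ s.re) : ‖mdiag F a‖ * s.re ^ m ≤ ‖mdiag F (c + s • a)‖ := by
  have := poly_lower (linePoly F c a) m (linePoly_natDegree F c a)
    (by rwa [linePoly_coeff_top]) (fun s hs => by rw [linePoly_eval]; exact h s hs) s hs
  rwa [linePoly_coeff_top, linePoly_eval] at this

theorem mdiag_logderiv {m : ℕ} (F : MultilinearMap ℂ (fun _ : Fin (m + 1) => V) ℂ)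
    (hF : IsSymmForm F) (c a : V)
    (ha : mdiag F a ≠ 0) (h : ∀ s : ℂ, 0 ≤ s.re → mdiag F (c + s • a) ≠ 0) :
    0 < (F (Fin.cons a (fun _ => c)) / mdiag F c).re := by
  have hd : 0 < (linePoly F c a).natDegree := by
    have := Polynomial.le_natDegree_of_ne_zero (p := linePoly F c a) (n := m + 1)
      (by rwa [linePoly_coeff_top])
    omega
  have := poly_logderiv (linePoly F c a) hd
    (fun s hs => by rw [linePoly_eval]; exact h s hs)
  rw [linePoly_coeff_one F hF, linePoly_coeff_zero, mul_div_assoc] at this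
  have h2 : ((m : ℂ) + 1) = ((m + 1 : ℝ) : ℂ) := by push_cast; rfl
  rw [h2, Complex.re_ofReal_mul] at this
  exact pos_of_mul_pos_right this (by positivity)

variable [TopologicalSpace V] [ContinuousAdd V] [ContinuousSMul ℂ V]

theorem mdiag_continuous {m : ℕ} (F : MultilinearMap ℂ (fun _ : Fin m => V) ℂ)
    (hc : Continuous F) : Continuous (mdiag F) :=
  hc.comp (continuous_pi fun _ => continuous_id)

theorem root_homotopy {m : ℕ} (F : MultilinearMap ℂ (fun _ : Fin m => V) ℂ)
    (hcont : Continuous F) {T : Type*} [TopologicalSpace T] [PreconnectedSpace T]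
    (c : T → V) (hc : Continuous c) (a : V) (ha : mdiag F a ≠ 0)
    (hb : ∀ θ, ∀ s : ℂ, s.re = 0 → mdiag F (c θ + s • a) ≠ 0)
    (θ₀ : T) (h0 : ∀ s : ℂ, 0 ≤ s.re → mdiag F (c θ₀ + s • a) ≠ 0) (θ : T) :
    ∀ s : ℂ, 0 ≤ s.re → mdiag F (c θ + s • a) ≠ 0 := by
  have hp := mdiag_continuous F hcont
  let G : Set T := {θ | ∀ s : ℂ, 0 ≤ s.re → mdiag F (c θ + s • a) ≠ 0}
  have hGclosed : IsClosed G := by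
    have : G = ⋂ s : {s : ℂ // 0 ≤ s.re},
        {θ | ‖mdiag F a‖ * s.1.re ^ m ≤ ‖mdiag F (c θ + s.1 • a)‖} := by
      ext θ
      simp only [Set.mem_iInter, Set.mem_setOf_eq, Subtype.forall, G]
      constructor
      · intro h s hs
        exact mdiag_lower F _ a ha h s hs
      · intro h s hs
        rcases hs.eq_or_lt with h1 | h1
        · exact hb θ s h1.symm
        · have := h s hs
          have h3 : 0 < ‖mdiag F a‖ := norm_pos_iff.2 ha
          exact norm_pos_iff.1 (lt_of_lt_of_le (by positivity) this)
    rw [this]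
    refine isClosed_iInter fun s => isClosed_le continuous_const ?_
    exact (hp.comp (hc.add continuous_const)).norm
  have hGopen : IsOpen G := by
    let K : Set ℂ := Metric.closedBall 0 1 ∩ {s | 0 ≤ s.re}
    have hK : IsCompact K := (isCompact_closedBall _ _).inter_right
      (isClosed_le continuous_const Complex.continuous_re)
    haveI : CompactSpace K := isCompact_iff_compactSpace.1 hK
    have hcl := isClosedMap_fst_of_compactSpace (X := T) (Y := K)
    have h1 : IsClosed {q : T × K | mdiag F (c q.1 + (q.2 : ℂ) • a) = 0} := by
      refine isClosed_eq (hp.comp ?_) continuous_const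
      exact (hc.comp continuous_fst).add
        ((continuous_subtype_val.comp continuous_snd).smul continuous_const)
    have h2 : IsClosed {q : T × K | mdiag F ((q.2 : ℂ) • c q.1 + a) = 0} := by
      refine isClosed_eq (hp.comp ?_) continuous_const
      exact ((continuous_subtype_val.comp continuous_snd).smul (hc.comp continuous_fst)).add
        continuous_const
    have h3 := (hcl _ h1).union (hcl _ h2)
    rw [← isClosed_compl_iff]
    convert h3 using 1
    ext θ
    simp only [G, Set.mem_compl_iff, Set.mem_setOf_eq, Set.mem_union, Set.mem_image, Prod.exists,
      Subtype.exists, exists_and_right, exists_eq_right]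
    push Not
    have hKm : ∀ s : ℂ, s ∈ K ↔ ‖s‖ ≤ 1 ∧ 0 ≤ s.re := by intro s; simp [K]
    constructor
    · rintro ⟨s, hs, hz⟩
      by_cases hn : ‖s‖ ≤ 1
      · exact Or.inl ⟨s, (hKm s).2 ⟨hn, hs⟩, hz⟩
      · right
        have hs0 : s ≠ 0 := by rintro rfl; simp at hn
        refine ⟨s⁻¹, (hKm _).2 ⟨?_, ?_⟩, ?_⟩
        · rw [norm_inv]; exact inv_le_one_of_one_le₀ (not_le.1 hn).le
        · rw [Complex.inv_re]; exact div_nonneg hs (Complex.normSq_nonneg _)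
        · have : s⁻¹ • c θ + a = s⁻¹ • (c θ + s • a) := by
            rw [smul_add, smul_smul, inv_mul_cancel₀ hs0, one_smul]
          rw [this, mdiag_smul, hz, mul_zero]
    · rintro (⟨s, hs, hz⟩ | ⟨u, hu, hz⟩)
      · exact ⟨s, ((hKm s).1 hs).2, hz⟩
      · have hu0 : u ≠ 0 := by
          rintro rfl
          simp at hz
          exact ha hz
        refine ⟨u⁻¹, ?_, ?_⟩
        · rw [Complex.inv_re]; exact div_nonneg ((hKm u).1 hu).2 (Complex.normSq_nonneg _)
        · have : c θ + u⁻¹ • a = u⁻¹ • (u • c θ + a) := by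
            rw [smul_add, smul_smul, inv_mul_cancel₀ hu0, one_smul]
          rw [this, mdiag_smul, hz, mul_zero]
  have hu : G = Set.univ := IsClopen.eq_univ ⟨hGclosed, hGopen⟩ ⟨θ₀, h0⟩
  have : θ ∈ G := by rw [hu]; trivial
  exact this

end multilin

section hyp
variable {V : Type*} [AddCommGroup V] [Module ℂ V]
variable [TopologicalSpace V] [ContinuousAdd V] [ContinuousSMul ℂ V]

/-- Hyperbolicity of a symmetric form with respect to a direction `e` in the real part `R`. -/
structure HypForm (R : AddSubgroup V) {m : ℕ} (F : MultilinearMap ℂ (fun _ : Fin m => V) ℂ)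
    (e : V) : Prop where
  cont : Continuous F
  symm : IsSymmForm F
  smul_mem : ∀ (t : ℝ) (x : V), x ∈ R → (t : ℂ) • x ∈ R
  real : ∀ v : Fin m → V, (∀ i, v i ∈ R) → (F v).im = 0
  mem : e ∈ R
  pos : 0 < (mdiag F e).re
  hyp : ∀ x ∈ R, ∀ z : ℂ, 0 < z.im → mdiag F (x + z • e) ≠ 0

/-- The Garding cone of a hyperbolic form. -/
def InCone (R : AddSubgroup V) {m : ℕ} (F : MultilinearMap ℂ (fun _ : Fin m => V) ℂ)
    (e a : V) : Prop :=
  a ∈ R ∧ ∀ t : ℝ, 0 ≤ t → 0 < (mdiag F (a + (t : ℂ) • e)).re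

theorem ne_zero_of_re_pos {z : ℂ} (h : 0 < z.re) : z ≠ 0 := by
  rintro rfl; simp at h

theorem mdiag_neg_ne {m : ℕ} (F : MultilinearMap ℂ (fun _ : Fin m => V) ℂ) {x : V}
    (h : mdiag F (-x) ≠ 0) : mdiag F x ≠ 0 := by
  intro h2
  apply h
  have : -x = (-1 : ℂ) • x := by simp
  rw [this, mdiag_smul, h2, mul_zero]

variable {R : AddSubgroup V} {e : V}

theorem HypForm.ne_of_im_ne {m : ℕ} {F : MultilinearMap ℂ (fun _ : Fin m => V) ℂ}
    (H : HypForm R F e) {x : V} (hx : x ∈ R) {z : ℂ} (hz : z.im ≠ 0) :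
    mdiag F (x + z • e) ≠ 0 := by
  rcases lt_or_gt_of_ne hz with h | h
  · apply mdiag_neg_ne
    have : -(x + z • e) = -x + (-z) • e := by rw [neg_add, neg_smul]
    rw [this]
    exact H.hyp _ (R.neg_mem hx) _ (by simpa using h)
  · exact H.hyp x hx z h

theorem InCone.ne {m : ℕ} {F : MultilinearMap ℂ (fun _ : Fin m => V) ℂ}
    (H : HypForm R F e) {a : V} (ha : InCone R F e a) {w : ℂ} (hw : w.im = 0 → 0 ≤ w.re) :
    mdiag F (a + w • e) ≠ 0 := by
  by_cases h : w.im = 0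
  · have h1 := ha.2 w.re (hw h)
    have h2 : ((w.re : ℝ) : ℂ) = w := by
      apply Complex.ext <;> simp [h]
    rw [h2] at h1
    exact ne_zero_of_re_pos h1
  · exact H.ne_of_im_ne ha.1 h

theorem InCone.self_pos {m : ℕ} {F : MultilinearMap ℂ (fun _ : Fin m => V) ℂ}
    {a : V} (ha : InCone R F e a) : 0 < (mdiag F a).re := by
  simpa using ha.2 0 le_rfl

theorem InCone.stable {m : ℕ} {F : MultilinearMap ℂ (fun _ : Fin m => V) ℂ}
    (H : HypForm R F e) {a : V} (ha : InCone R F e a) {x : V} (hx : x ∈ R) {z : ℂ}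
    (hz : 0 < z.im) (s : ℂ) (hs : 0 ≤ s.re) :
    mdiag F ((x + z • e) + s • (Complex.I • a)) ≠ 0 := by
  have hane := ne_zero_of_re_pos ha.self_pos
  have := root_homotopy F H.cont (T := unitInterval)
    (fun θ => (((θ : ℝ) : ℂ) • x + z • e))
    (by
      refine Continuous.add (Continuous.smul ?_ continuous_const) continuous_const
      exact Complex.continuous_ofReal.comp continuous_subtype_val)
    (Complex.I • a)
    (by rw [mdiag_smul]; exact mul_ne_zero (pow_ne_zero _ Complex.I_ne_zero) hane)
    (by
      intro θ s hs
      have h1 : s * Complex.I = ((-s.im : ℝ) : ℂ) := by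
        apply Complex.ext <;> simp [hs]
      have h2 : (((θ : ℝ) : ℂ) • x + z • e) + s • (Complex.I • a)
          = (((θ : ℝ) : ℂ) • x + ((-s.im : ℝ) : ℂ) • a) + z • e := by
        rw [smul_smul, h1]; abel
      rw [h2]
      exact H.hyp _ (R.add_mem (H.smul_mem _ _ hx) (H.smul_mem _ _ ha.1)) _ hz)
    0
    (by
      intro s hs
      have hz0 : z ≠ 0 := by rintro rfl; simp at hz
      by_cases hs0 : s = 0
      · subst hs0
        have : mdiag F (z • e) ≠ 0 := by
          rw [mdiag_smul]; exact mul_ne_zero (pow_ne_zero _ hz0) (ne_zero_of_re_pos H.pos)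
        simpa using this
      · have hsI : s * Complex.I ≠ 0 := mul_ne_zero hs0 Complex.I_ne_zero
        have h2 : ((((0 : unitInterval) : ℝ) : ℂ) • x + z • e) + s • (Complex.I • a)
            = (s * Complex.I) • (a + (z / (s * Complex.I)) • e) := by
          rw [smul_add, smul_smul, smul_smul, mul_div_cancel₀ _ hsI]
          simp [add_comm]
        rw [h2, mdiag_smul]
        refine mul_ne_zero (pow_ne_zero _ hsI) (ha.ne H ?_)
        intro hw
        by_contra hneg
        have h3 : z = (z / (s * Complex.I)) * (s * Complex.I) := by
          field_simp
        have h4 := congrArg Complex.im h3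
        rw [Complex.mul_im, hw] at h4
        simp at h4 hneg
        simp only [Complex.I] at *
        nlinarith)
    1 s hs
  simpa using this

/-- `F` is hyperbolic with respect to each element of the cone. -/
theorem InCone.hyp {m : ℕ} {F : MultilinearMap ℂ (fun _ : Fin m => V) ℂ}
    (H : HypForm R F e) {a : V} (ha : InCone R F e a) {x : V} (hx : x ∈ R) {s : ℂ}
    (hs : 0 < s.im) : mdiag F (x + s • a) ≠ 0 := by
  have hane := ne_zero_of_re_pos ha.self_pos
  have hIa : mdiag F (Complex.I • a) ≠ 0 := by
    rw [mdiag_smul]; exact mul_ne_zero (pow_ne_zero _ Complex.I_ne_zero) hane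
  have hre : (s * (-Complex.I)).re = s.im := by simp
  have hlow : ∀ ε : ℝ, 0 < ε → ‖mdiag F (Complex.I • a)‖ * s.im ^ m ≤
      ‖mdiag F ((x + ((ε : ℂ) * Complex.I) • e) + s • a)‖ := by
    intro ε hε
    have h := mdiag_lower F (x + ((ε : ℂ) * Complex.I) • e) (Complex.I • a) hIa
      (fun s hs => ha.stable H hx (by simpa using hε) s hs) (s * (-Complex.I))
      (by rw [hre]; exact hs.le)
    rw [hre, smul_smul] at h
    have : s * (-Complex.I) * Complex.I = s := by
      rw [mul_assoc]; simp
    rwa [this] at h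
  have hcont : Continuous (fun ε : ℝ => ‖mdiag F ((x + ((ε : ℂ) * Complex.I) • e) + s • a)‖) := by
    refine ((mdiag_continuous F H.cont).comp ?_).norm
    refine Continuous.add (Continuous.add continuous_const (Continuous.smul ?_ continuous_const))
      continuous_const
    exact Complex.continuous_ofReal.mul continuous_const
  have hlim : ‖mdiag F (Complex.I • a)‖ * s.im ^ m ≤
      ‖mdiag F ((x + (((0 : ℝ) : ℂ) * Complex.I) • e) + s • a)‖ := by
    refine ge_of_tendsto ((hcont.tendsto 0).mono_left
      (nhdsWithin_le_nhds (s := Set.Ioi (0 : ℝ)))) ?_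
    filter_upwards [self_mem_nhdsWithin] with ε hε
    exact hlow ε hε
  have h3 : 0 < ‖mdiag F (Complex.I • a)‖ := norm_pos_iff.2 hIa
  have h4 := norm_pos_iff.1 (lt_of_lt_of_le (by positivity) hlim)
  simpa using h4

theorem InCone.half {m : ℕ} {F : MultilinearMap ℂ (fun _ : Fin m => V) ℂ}
    (H : HypForm R F e) {a b : V} (ha : InCone R F e a) (hb : InCone R F e b)
    (s : ℂ) (hs : 0 ≤ s.re) : mdiag F (b + s • a) ≠ 0 := by
  have hane := ne_zero_of_re_pos ha.self_pos
  have hmem : ∀ θ : unitInterval, (((1 - θ : ℝ)) : ℂ) • e + ((θ : ℝ) : ℂ) • b ∈ R := fun θ =>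
    R.add_mem (H.smul_mem _ _ H.mem) (H.smul_mem _ _ hb.1)
  have := root_homotopy F H.cont (T := unitInterval)
    (fun θ => (((1 - θ : ℝ)) : ℂ) • e + ((θ : ℝ) : ℂ) • b)
    (by
      refine Continuous.add (Continuous.smul ?_ continuous_const)
        (Continuous.smul ?_ continuous_const)
      · exact Complex.continuous_ofReal.comp (continuous_const.sub continuous_subtype_val)
      · exact Complex.continuous_ofReal.comp continuous_subtype_val)
    a hane
    (by
      intro θ s hs
      rcases lt_trichotomy s.im 0 with h | h | h
      · apply mdiag_neg_ne
        rw [neg_add, ← neg_smul]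
        exact ha.hyp H (R.neg_mem (hmem θ)) (by simpa using h)
      · have hs0 : s = 0 := Complex.ext hs h
        subst hs0
        rw [zero_smul, add_zero]
        by_cases hθ : (θ : ℝ) = 0
        · rw [hθ]; simpa using ne_zero_of_re_pos H.pos
        · have hθp : (0 : ℝ) < θ := lt_of_le_of_ne θ.2.1 (Ne.symm hθ)
          have hθc : ((θ : ℝ) : ℂ) ≠ 0 := by exact_mod_cast hθ
          have h2 : (((1 - θ : ℝ)) : ℂ) • e + ((θ : ℝ) : ℂ) • b
              = ((θ : ℝ) : ℂ) • (b + (((1 - θ) / θ : ℝ) : ℂ) • e) := by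
            rw [smul_add, smul_smul, ← Complex.ofReal_mul, mul_div_cancel₀ _ hθ, add_comm]
          rw [h2, mdiag_smul]
          refine mul_ne_zero (pow_ne_zero _ hθc) (ne_zero_of_re_pos (hb.2 _ ?_))
          exact div_nonneg (by linarith [θ.2.2]) hθp.le
      · exact ha.hyp H (hmem θ) h)
    0
    (by
      intro s hs
      by_cases hs0 : s = 0
      · subst hs0
        simpa using ne_zero_of_re_pos H.pos
      · have h2 : ((((1 - (0 : unitInterval) : ℝ)) : ℂ) • e + (((0 : unitInterval) : ℝ) : ℂ) • b)
            + s • a = s • (a + s⁻¹ • e) := by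
          rw [smul_add, smul_smul, mul_inv_cancel₀ hs0]
          simp [add_comm]
        rw [h2, mdiag_smul]
        refine mul_ne_zero (pow_ne_zero _ hs0) (ha.ne H ?_)
        intro _
        rw [Complex.inv_re]
        exact div_nonneg hs (Complex.normSq_nonneg _))
    1 s hs
  simpa using this

theorem InCone.shift {m : ℕ} {F : MultilinearMap ℂ (fun _ : Fin m => V) ℂ}
    (H : HypForm R F e) {b : V} (hb : InCone R F e b) {t : ℝ} (ht : 0 ≤ t) :
    InCone R F e (b + (t : ℂ) • e) := by
  refine ⟨R.add_mem hb.1 (H.smul_mem _ _ H.mem), fun u hu => ?_⟩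
  have := hb.2 (t + u) (by positivity)
  rwa [Complex.ofReal_add, add_smul, ← add_assoc] at this

theorem HypForm.cone_self {m : ℕ} {F : MultilinearMap ℂ (fun _ : Fin m => V) ℂ}
    (H : HypForm R F e) : InCone R F e e := by
  refine ⟨H.mem, fun t ht => ?_⟩
  have : e + (t : ℂ) • e = ((1 + t : ℝ) : ℂ) • e := by
    push_cast; rw [add_smul, one_smul]
  rw [this, mdiag_smul, ← Complex.ofReal_pow, Complex.re_ofReal_mul]
  have := H.pos
  positivity

theorem InCone.deriv_pos {m : ℕ} {F : MultilinearMap ℂ (fun _ : Fin (m + 1) => V) ℂ}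
    (H : HypForm R F e) {a b : V} (ha : InCone R F e a) (hb : InCone R F e b) :
    0 < (mdiag (F.curryLeft a) b).re := by
  have h := mdiag_logderiv F H.symm b a (ne_zero_of_re_pos ha.self_pos) (ha.half H hb)
  have hbp := hb.self_pos
  have hbi : (mdiag F b).im = 0 := H.real _ fun _ => hb.1
  have hbe : mdiag F b = (((mdiag F b).re : ℝ) : ℂ) := by
    apply Complex.ext <;> simp [hbi]
  rw [hbe, Complex.div_ofReal_re] at h
  have := (div_pos_iff_of_pos_right hbp).1 h
  simpa [mdiag, MultilinearMap.curryLeft_apply] using this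

theorem HypForm.deriv {m : ℕ} {F : MultilinearMap ℂ (fun _ : Fin (m + 1) => V) ℂ}
    (H : HypForm R F e) {a : V} (ha : InCone R F e a) : HypForm R (F.curryLeft a) e where
  cont := by
    have : (⇑(F.curryLeft a)) = fun v => F (Fin.cons a v) := by
      funext v; simp
    rw [this]
    refine H.cont.comp (continuous_pi fun i => ?_)
    refine Fin.cases ?_ (fun j => ?_) i
    · simpa using continuous_const
    · simpa using continuous_apply j
  symm := by
    intro σ v
    have h := H.symm (Equiv.Perm.decomposeFin.symm (0, σ)) (Fin.cons a v)
    rw [MultilinearMap.curryLeft_apply, MultilinearMap.curryLeft_apply, ← h]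
    congr 1
    funext i
    refine Fin.cases ?_ (fun j => ?_) i
    · simp
    · simp
  smul_mem := H.smul_mem
  real := by
    intro v hv
    rw [MultilinearMap.curryLeft_apply]
    refine H.real _ fun i => ?_
    refine Fin.cases ?_ (fun j => ?_) i
    · simpa using ha.1
    · simpa using hv j
  mem := H.mem
  pos := ha.deriv_pos H H.cone_self
  hyp := by
    intro x hx z hz h0
    have hane := ne_zero_of_re_pos ha.self_pos
    have hIa : mdiag F (Complex.I • a) ≠ 0 := by
      rw [mdiag_smul]; exact mul_ne_zero (pow_ne_zero _ Complex.I_ne_zero) hane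
    have h := mdiag_logderiv F H.symm (x + z • e) (Complex.I • a) hIa
      (fun s hs => ha.stable H hx hz s hs)
    have h2 : F (Fin.cons (Complex.I • a) (fun _ => x + z • e))
        = Complex.I * mdiag (F.curryLeft a) (x + z • e) := by
      have : F (Fin.cons (Complex.I • a) (fun _ => x + z • e))
        = F.curryLeft (Complex.I • a) (fun _ => x + z • e) := by
          rw [MultilinearMap.curryLeft_apply]
      rw [this, map_smul]
      rfl
    rw [h2, h0] at h
    simp at h

theorem garding_pos : ∀ (m : ℕ) (F : MultilinearMap ℂ (fun _ : Fin m => V) ℂ),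
    HypForm R F e → ∀ a : Fin m → V, (∀ i, InCone R F e (a i)) → 0 < (F a).re := by
  intro m
  induction m with
  | zero =>
    intro F H a _
    have := H.pos
    rwa [mdiag, Subsingleton.elim (fun _ => e) a] at this
  | succ m ih =>
    intro F H a ha
    have h := ih (F.curryLeft (a 0)) (H.deriv (ha 0)) (fun i => a i.succ) (fun i =>
      ⟨(ha i.succ).1, fun t ht => (ha 0).deriv_pos H ((ha i.succ).shift H ht)⟩)
    rw [MultilinearMap.curryLeft_apply] at h
    have h2 : (Fin.cons (a 0) (fun i => a i.succ) : Fin (m + 1) → V) = a := by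
      funext i
      refine Fin.cases ?_ (fun j => ?_) i <;> simp
    rwa [h2] at h

end hyp

section concrete

/-- The complexified polarized form (without the factorial normalisation). -/
noncomputable def polForm (n k : ℕ) :
    MultilinearMap ℂ (fun _ : Fin k => Matrix (Fin n) (Fin n) ℂ) ℂ :=
  ∑ i : Fin k → Fin n, ∑ j : Fin k → Fin n, ((gkdelta i j : ℝ) : ℂ) •
    (MultilinearMap.mkPiAlgebra ℂ (Fin k) ℂ).compLinearMap
      (fun a => Matrix.entryLinearMap ℂ ℂ (i a) (j a))

theorem polForm_apply (n k : ℕ) (v : Fin k → Matrix (Fin n) (Fin n) ℂ) :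
    polForm n k v = ∑ i : Fin k → Fin n, ∑ j : Fin k → Fin n,
      ((gkdelta i j : ℝ) : ℂ) * ∏ a : Fin k, v a (i a) (j a) := by
  simp [polForm]

theorem polForm_ofReal (n k : ℕ) (A : Fin k → Matrix (Fin n) (Fin n) ℝ) :
    polForm n k (fun a => (A a).map Complex.ofReal) =
      ((∑ i : Fin k → Fin n, ∑ j : Fin k → Fin n,
        gkdelta i j * ∏ a : Fin k, A a (i a) (j a) : ℝ) : ℂ) := by
  rw [polForm_apply]; push_cast; simp

theorem polForm_cont (n k : ℕ) : Continuous (polForm n k) := by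
  have : ⇑(polForm n k) = fun v => ∑ i : Fin k → Fin n, ∑ j : Fin k → Fin n,
      ((gkdelta i j : ℝ) : ℂ) * ∏ a : Fin k, v a (i a) (j a) := by
    funext v; exact polForm_apply n k v
  rw [this]
  refine continuous_finsetSum _ fun i _ => continuous_finsetSum _ fun j _ =>
    continuous_const.mul (continuous_finsetProd _ fun a _ => ?_)
  exact (continuous_apply a).matrix_elem _ _

theorem gkdelta_comp {n k : ℕ} (σ : Equiv.Perm (Fin k)) (i j : Fin k → Fin n) :
    gkdelta (fun a => i (σ a)) (fun a => j (σ a)) = gkdelta i j := by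
  unfold gkdelta
  exact Matrix.det_submatrix_equiv_self σ
    (Matrix.of fun a b : Fin k => if i a = j b then (1 : ℝ) else 0)

theorem polForm_symm (n k : ℕ) : IsSymmForm (polForm n k) := by
  intro σ v
  rw [polForm_apply, polForm_apply]
  let E : (Fin k → Fin n) ≃ (Fin k → Fin n) := Equiv.arrowCongr σ.symm (Equiv.refl _)
  have hE : ∀ i a, E i a = i (σ a) := by intro i a; simp [E, Equiv.arrowCongr]
  rw [← Equiv.sum_comp E]
  refine Finset.sum_congr rfl fun i _ => ?_
  rw [← Equiv.sum_comp E]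
  refine Finset.sum_congr rfl fun j _ => ?_
  have h1 : E i = fun a => i (σ a) := funext (hE i)
  have h2 : E j = fun a => j (σ a) := funext (hE j)
  rw [h1, h2, gkdelta_comp]
  congr 1
  exact Equiv.prod_comp σ (fun a => v a (i a) (j a))

/-- Tensor power of a matrix. -/
noncomputable def tpow (n k : ℕ) (M : Matrix (Fin n) (Fin n) ℂ) :
    Matrix (Fin k → Fin n) (Fin k → Fin n) ℂ :=
  Matrix.of fun i j => ∏ a, M (i a) (j a)

theorem tpow_mul (n k : ℕ) (M N : Matrix (Fin n) (Fin n) ℂ) :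
    tpow n k (M * N) = tpow n k M * tpow n k N := by
  ext i j
  simp only [tpow, Matrix.of_apply, Matrix.mul_apply]
  rw [Finset.prod_univ_sum, Fintype.piFinset_univ]
  simp [Finset.prod_mul_distrib]

/-- Matrix of generalized Kronecker deltas. -/
noncomputable def gkMat (n k : ℕ) : Matrix (Fin k → Fin n) (Fin k → Fin n) ℂ :=
  Matrix.of fun i j => ((gkdelta j i : ℝ) : ℂ)

theorem mdiag_polForm (n k : ℕ) (M : Matrix (Fin n) (Fin n) ℂ) :
    mdiag (polForm n k) M = (tpow n k M * gkMat n k).trace := by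
  rw [mdiag, polForm_apply]
  simp only [Matrix.trace, Matrix.diag, Matrix.mul_apply, tpow, gkMat, Matrix.of_apply]
  simp only [mul_comm]

theorem gkdelta_eq {n k : ℕ} (i j : Fin k → Fin n) :
    ((gkdelta i j : ℝ) : ℂ) = ∑ π : Equiv.Perm (Fin k),
      (((Equiv.Perm.sign π : ℤ)) : ℂ) * if (fun b => i (π b)) = j then 1 else 0 := by
  rw [gkdelta, Matrix.det_apply']
  push_cast
  refine Finset.sum_congr rfl fun π _ => ?_
  congr 1
  simp only [Matrix.of_apply]
  by_cases h : (fun b => i (π b)) = j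
  · rw [if_pos h]
    refine Finset.prod_eq_one fun b _ => ?_
    rw [if_pos (congrFun h b)]; simp
  · rw [if_neg h]
    obtain ⟨b, hb⟩ := Function.ne_iff.1 h
    refine Finset.prod_eq_zero (Finset.mem_univ b) ?_
    rw [if_neg hb]; simp

theorem tpow_comm (n k : ℕ) (M : Matrix (Fin n) (Fin n) ℂ) :
    tpow n k M * gkMat n k = gkMat n k * tpow n k M := by
  ext i j
  simp only [Matrix.mul_apply, tpow, gkMat, Matrix.of_apply, gkdelta_eq, Finset.mul_sum,
    Finset.sum_mul]
  rw [Finset.sum_comm]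
  conv_rhs => rw [Finset.sum_comm]
  refine Finset.sum_congr rfl fun π _ => ?_
  have hR : ∀ l : Fin k → Fin n, ((fun b => l (π b)) = i) ↔ (fun b => i (π.symm b)) = l := by
    intro l
    constructor
    · rintro rfl; funext b; simp
    · rintro rfl; funext b; simp
  simp only [hR, mul_ite, ite_mul, mul_one, mul_zero, zero_mul, Finset.sum_ite_eq,
    Finset.mem_univ, if_true]
  rw [mul_comm]
  congr 1
  rw [← Equiv.prod_comp π (fun a => M (i (π.symm a)) (j a))]
  simp only [Equiv.symm_apply_apply]

theorem mdiag_polForm_conj (n k : ℕ) (P Q M : Matrix (Fin n) (Fin n) ℂ) (h : Q * P = 1) :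
    mdiag (polForm n k) (P * M * Q) = mdiag (polForm n k) M := by
  rw [mdiag_polForm, mdiag_polForm, tpow_mul, Matrix.mul_assoc, tpow_comm,
    ← Matrix.mul_assoc, Matrix.trace_mul_comm, ← Matrix.mul_assoc,
    ← tpow_mul, ← Matrix.mul_assoc, h, Matrix.one_mul]

theorem gkdelta_self {n k : ℕ} (i : Fin k → Fin n) [Decidable (Function.Injective i)] :
    gkdelta i i = if Function.Injective i then 1 else 0 := by
  unfold gkdelta
  split_ifs with h
  · convert Matrix.det_one (n := Fin k) (R := ℝ)
    ext a b
    simp [Matrix.one_apply, h.eq_iff]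
  · rw [Function.Injective] at h
    push Not at h
    obtain ⟨a, b, hab, hne⟩ := h
    refine Matrix.det_zero_of_row_eq hne ?_
    funext c
    simp [hab]

theorem card_enum {n k : ℕ} (S : Finset (Fin n)) (hS : S.card = k) :
    (Finset.univ.filter (fun i : Fin k → Fin n =>
      Function.Injective i ∧ Finset.univ.image i = S)).card = k.factorial := by
  classical
  have e0 : Fin k ≃ S := (S.equivFinOfCardEq hS).symm
  have h1 : Fintype.card (Fin k ≃ S) = k.factorial := by
    rw [Fintype.card_equiv e0, Fintype.card_fin]
  rw [← h1, ← Finset.card_univ]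
  symm
  refine Finset.card_bij (fun e _ => fun a => ((e a : S) : Fin n)) ?_ ?_ ?_
  · intro e _
    simp only [Finset.mem_filter, Finset.mem_univ, true_and]
    refine ⟨fun a b hab => e.injective (Subtype.ext hab), ?_⟩
    ext x
    simp only [Finset.mem_image, Finset.mem_univ, true_and]
    constructor
    · rintro ⟨a, rfl⟩; exact (e a).2
    · intro hx; exact ⟨e.symm ⟨x, hx⟩, by simp⟩
  · intro e _ f _ h
    ext a
    exact congrArg Fin.val (congrFun h a)
  · intro i hi
    simp only [Finset.mem_filter, Finset.mem_univ, true_and] at hi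
    obtain ⟨hinj, him⟩ := hi
    have hm : ∀ a, i a ∈ S := fun a => by
      rw [← him]; exact Finset.mem_image_of_mem i (Finset.mem_univ a)
    refine ⟨Equiv.ofBijective (fun a => (⟨i a, hm a⟩ : S)) ⟨?_, ?_⟩, Finset.mem_univ _, ?_⟩
    · intro a b hab
      exact hinj (congrArg Subtype.val hab)
    · rintro ⟨x, hx⟩
      rw [← him] at hx
      obtain ⟨a, _, ha⟩ := Finset.mem_image.1 hx
      exact ⟨a, Subtype.ext ha⟩
    · funext a; rfl

theorem mdiag_polForm_diagonal (n k : ℕ) (d : Fin n → ℂ) :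
    mdiag (polForm n k) (Matrix.diagonal d) =
      (k.factorial : ℂ) * ∑ S ∈ Finset.powersetCard k (Finset.univ : Finset (Fin n)),
        ∏ x ∈ S, d x := by
  classical
  rw [mdiag, polForm_apply]
  have h1 : ∀ i j : Fin k → Fin n, ∏ a, Matrix.diagonal d (i a) (j a)
      = if i = j then ∏ a, d (i a) else 0 := by
    intro i j
    split_ifs with h
    · subst h; simp
    · obtain ⟨b, hb⟩ := Function.ne_iff.1 h
      exact Finset.prod_eq_zero (Finset.mem_univ b) (Matrix.diagonal_apply_ne _ hb)
  simp only [h1, mul_ite, mul_zero, Finset.sum_ite_eq, Finset.mem_univ, if_true]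
  have h2 : ∀ i : Fin k → Fin n, ((gkdelta i i : ℝ) : ℂ) * ∏ a, d (i a)
      = if Function.Injective i then ∏ a, d (i a) else 0 := by
    intro i
    rw [gkdelta_self]
    split_ifs <;> simp
  simp only [h2]
  rw [← Finset.sum_filter, ← Finset.sum_fiberwise_of_maps_to
    (g := fun i : Fin k → Fin n => Finset.univ.image i)
    (t := Finset.powersetCard k (Finset.univ : Finset (Fin n))), Finset.mul_sum]
  · refine Finset.sum_congr rfl fun S hS => ?_
    rw [Finset.filter_filter]
    rw [Finset.sum_congr rfl (g := fun _ => ∏ x ∈ S, d x), Finset.sum_const,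
      card_enum S (Finset.mem_powersetCard.1 hS).2, nsmul_eq_mul]
    intro i hi
    simp only [Finset.mem_filter, Finset.mem_univ, true_and] at hi
    rw [← hi.2, Finset.prod_image (fun a _ b _ h => hi.1 h)]
  · intro i hi
    simp only [Finset.mem_filter, Finset.mem_univ, true_and] at hi
    rw [Finset.mem_powersetCard]
    exact ⟨Finset.subset_univ _, by rw [Finset.card_image_of_injective _ hi]; simp⟩

open Polynomial in
theorem esum_shift {K : Type*} [Field K] (n k : ℕ) (hkn : k ≤ n) (lam : Fin n → K) (z : K) :
    ∑ S ∈ Finset.powersetCard k (Finset.univ : Finset (Fin n)), ∏ x ∈ S, (lam x + z)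
      = (hasseDeriv (n - k) (∏ i : Fin n, (X + C (lam i)))).eval z := by
  rw [← taylor_coeff, taylor_apply, prod_comp]
  have h : ∀ i, (X + C (lam i)).comp (X + C z) = X + C (lam i + z) := by
    intro i; simp only [add_comp, X_comp, C_comp, C_add]; ring
  simp only [h]
  rw [Finset.prod_X_add_C_coeff _ _ (by simp)]
  simp [Nat.sub_sub_self hkn]

open Polynomial in
theorem deriv_nonvanish (Q : ℂ[X]) (hd : 0 < Q.natDegree)
    (h : ∀ z : ℂ, 0 < z.im → Q.eval z ≠ 0) :
    ∀ z : ℂ, 0 < z.im → (derivative Q).eval z ≠ 0 := by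
  intro z hz h0
  have hQ' : derivative Q ≠ 0 := by
    intro hh
    have := derivative_eq_zero.1 hh
    omega
  have hQ : Q ≠ 0 := by rintro rfl; simp at hd
  have hm : z ∈ (derivative Q).rootSet ℂ := by
    rw [mem_rootSet, coe_aeval_eq_eval]; exact ⟨hQ', h0⟩
  have h1 := rootSet_derivative_subset_convexHull_rootSet (natDegree_pos_iff_degree_pos.1 hd) hm
  have hsub : Q.rootSet ℂ ⊆ {w : ℂ | w.im ≤ 0} := by
    intro w hw
    rw [mem_rootSet, coe_aeval_eq_eval] at hw
    by_contra hh
    exact h w (not_le.1 hh) hw.2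
  have h2 := convexHull_min hsub (convex_halfSpace_im_le 0) h1
  exact absurd h2 (not_le.2 hz)

open Polynomial in
theorem iterate_deriv_nonvanish (Q : ℂ[X]) (h : ∀ z : ℂ, 0 < z.im → Q.eval z ≠ 0) (j : ℕ) :
    j ≤ Q.natDegree → (derivative^[j] Q).natDegree = Q.natDegree - j ∧
    ∀ z : ℂ, 0 < z.im → (derivative^[j] Q).eval z ≠ 0 := by
  induction j with
  | zero => intro _; exact ⟨by simp, by simpa using h⟩
  | succ j ih =>
    intro hj
    obtain ⟨h1, h2⟩ := ih (by omega)
    rw [Function.iterate_succ_apply']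
    refine ⟨?_, deriv_nonvanish _ (by omega) h2⟩
    rw [natDegree_derivative, h1]; omega

open Polynomial in
theorem esum_ne_zero (n k : ℕ) (hkn : k ≤ n) (lam : Fin n → ℝ) (z : ℂ) (hz : 0 < z.im) :
    ∑ S ∈ Finset.powersetCard k (Finset.univ : Finset (Fin n)), ∏ x ∈ S, ((lam x : ℂ) + z) ≠ 0 := by
  rw [esum_shift n k hkn]
  set Q : ℂ[X] := ∏ i : Fin n, (X + C (lam i : ℂ)) with hQdef
  have hQ : ∀ z : ℂ, 0 < z.im → Q.eval z ≠ 0 := by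
    intro z hz
    rw [hQdef, eval_prod]
    refine Finset.prod_ne_zero_iff.2 fun i _ => ?_
    intro h
    have := congrArg Complex.im h
    simp at this
    linarith
  have hdeg : Q.natDegree = n := by
    rw [hQdef, natDegree_prod_of_monic _ _ (fun i _ => monic_X_add_C _)]
    simp
  have h1 := (iterate_deriv_nonvanish Q hQ (n - k) (by omega)).2 z hz
  rw [← factorial_smul_hasseDeriv] at h1
  intro h0
  apply h1
  simp [h0]

open Polynomial in
theorem esum_pos (n k : ℕ) (hkn : k ≤ n) (lam : Fin n → ℝ) (h : inGamma n k lam) (hk : 1 ≤ k)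
    (t : ℝ) (ht : 0 ≤ t) :
    0 < ∑ S ∈ Finset.powersetCard k (Finset.univ : Finset (Fin n)), ∏ x ∈ S, (lam x + t) := by
  rw [esum_shift n k hkn]
  set Q : ℝ[X] := ∏ i : Fin n, (X + C (lam i)) with hQdef
  have hdeg : Q.natDegree = n := by
    rw [hQdef, natDegree_prod_of_monic _ _ (fun i _ => monic_X_add_C _)]
    simp
  have hco : ∀ i, n - k ≤ i → i ≤ n → 0 < Q.coeff i := by
    intro i h1 h2
    rw [hQdef, Finset.prod_X_add_C_coeff _ _ (by simpa using h2)]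
    simp only [Finset.card_univ, Fintype.card_fin]
    rcases Nat.eq_zero_or_pos (n - i) with h3 | h3
    · rw [h3]; simp
    · exact h (n - i) h3 (by omega)
  have hco2 : ∀ i, 0 ≤ (hasseDeriv (n - k) Q).coeff i := by
    intro i
    rw [hasseDeriv_coeff]
    by_cases hi : i + (n - k) ≤ n
    · exact mul_nonneg (by positivity) (hco _ (by omega) hi).le
    · rw [coeff_eq_zero_of_natDegree_lt (by omega)]; simp
  have hco0 : 0 < (hasseDeriv (n - k) Q).coeff 0 := by
    rw [hasseDeriv_coeff]
    have := hco (0 + (n - k)) (by omega) (by omega)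
    simp only [zero_add, Nat.choose_self, Nat.cast_one, one_mul] at *
    exact this
  rw [eval_eq_sum_range, Finset.sum_range_succ']
  refine add_pos_of_nonneg_of_pos (Finset.sum_nonneg fun i _ => ?_) (by simpa using hco0)
  exact mul_nonneg (hco2 _) (by positivity)

/-- Complexified real symmetric matrices. -/
def realSymm (n : ℕ) : AddSubgroup (Matrix (Fin n) (Fin n) ℂ) where
  carrier := {M | ∃ A : Matrix (Fin n) (Fin n) ℝ, A.IsHermitian ∧ M = A.map Complex.ofReal}
  zero_mem' := ⟨0, Matrix.isHermitian_zero, by ext; simp⟩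
  add_mem' := by
    rintro _ _ ⟨A, hA, rfl⟩ ⟨B, hB, rfl⟩
    exact ⟨A + B, hA.add hB, by ext; simp⟩
  neg_mem' := by
    rintro _ ⟨A, hA, rfl⟩
    exact ⟨-A, hA.neg, by ext; simp⟩

theorem mdiag_polForm_herm (n k : ℕ) (A : Matrix (Fin n) (Fin n) ℝ) (hA : A.IsHermitian) (z : ℂ) :
    mdiag (polForm n k) (A.map Complex.ofReal + z • (1 : Matrix (Fin n) (Fin n) ℂ)) =
      (k.factorial : ℂ) * ∑ S ∈ Finset.powersetCard k (Finset.univ : Finset (Fin n)),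
        ∏ x ∈ S, ((hA.eigenvalues x : ℂ) + z) := by
  rw [← mdiag_polForm_diagonal]
  let U : Matrix (Fin n) (Fin n) ℝ := hA.eigenvectorUnitary
  have hU : star U * U = 1 := Unitary.coe_star_mul_self hA.eigenvectorUnitary
  have hU' : U * star U = 1 := Unitary.coe_mul_star_self hA.eigenvectorUnitary
  have hsp : A = U * Matrix.diagonal hA.eigenvalues * star U := by
    have := hA.spectral_theorem
    rw [Unitary.conjStarAlgAut_apply] at this
    exact this
  let f : Matrix (Fin n) (Fin n) ℝ →+* Matrix (Fin n) (Fin n) ℂ := Complex.ofRealHom.mapMatrix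
  have hf : ∀ B, B.map Complex.ofReal = f B := fun B => rfl
  have h1 : f (star U) * f U = 1 := by rw [← map_mul, hU, map_one]
  have h2 : f U * f (star U) = 1 := by rw [← map_mul, hU', map_one]
  have h3 : A.map Complex.ofReal + z • (1 : Matrix (Fin n) (Fin n) ℂ)
      = f U * Matrix.diagonal (fun x => (hA.eigenvalues x : ℂ) + z) * f (star U) := by
    have h4 : Matrix.diagonal (fun x => (hA.eigenvalues x : ℂ) + z)
        = f (Matrix.diagonal hA.eigenvalues) + z • (1 : Matrix (Fin n) (Fin n) ℂ) := by
      ext a b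
      by_cases hab : a = b
      · subst hab; simp [f]
      · simp [f, hab]
    rw [h4, Matrix.mul_add, Matrix.add_mul, ← map_mul, ← map_mul, ← hsp, ← hf]
    congr 1
    rw [Matrix.mul_smul, Matrix.smul_mul, Matrix.mul_one, h2]
  rw [h3, mdiag_polForm_conj _ _ _ _ _ h1]

theorem polForm_cone (n k : ℕ) (hk : 1 ≤ k) (hkn : k ≤ n) (A : Matrix (Fin n) (Fin n) ℝ)
    (hA : A.IsHermitian) (h : inGamma n k hA.eigenvalues) :
    InCone (realSymm n) (polForm n k) 1 (A.map Complex.ofReal) := by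
  refine ⟨⟨A, hA, rfl⟩, fun t ht => ?_⟩
  rw [mdiag_polForm_herm n k A hA]
  have h1 := esum_pos n k hkn _ h hk t ht
  have h2 : (k.factorial : ℂ) * ∑ S ∈ Finset.powersetCard k (Finset.univ : Finset (Fin n)),
        ∏ x ∈ S, ((hA.eigenvalues x : ℂ) + (t : ℂ)) =
      (((k.factorial : ℝ) * ∑ S ∈ Finset.powersetCard k (Finset.univ : Finset (Fin n)),
        ∏ x ∈ S, (hA.eigenvalues x + t) : ℝ) : ℂ) := by
    push_cast; rfl
  rw [h2, Complex.ofReal_re]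
  positivity

theorem polForm_hyp (n k : ℕ) (hkn : k ≤ n) : HypForm (realSymm n) (polForm n k) 1 where
  cont := polForm_cont n k
  symm := polForm_symm n k
  smul_mem := by
    rintro t _ ⟨A, hA, rfl⟩
    refine ⟨t • A, ?_, by ext; simp⟩
    rw [Matrix.IsHermitian, Matrix.conjTranspose_smul, hA.eq]; simp
  real := by
    intro v hv
    choose A hA hvA using hv
    have : v = fun a => (A a).map Complex.ofReal := funext hvA
    rw [this, polForm_ofReal, Complex.ofReal_im]
  mem := ⟨1, Matrix.isHermitian_one, by ext a b; by_cases h : a = b <;> simp [Matrix.one_apply, h]⟩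
  pos := by
    rw [← Matrix.diagonal_one, mdiag_polForm_diagonal]
    have : 0 < n.choose k := Nat.choose_pos hkn
    simp only [Finset.prod_const_one, Finset.sum_const, Finset.card_powersetCard,
      Finset.card_univ, Fintype.card_fin, nsmul_eq_mul, mul_one]
    rw [← Nat.cast_mul, Complex.natCast_re]
    have := Nat.factorial_pos k
    positivity
  hyp := by
    rintro _ ⟨A, hA, rfl⟩ z hz
    rw [mdiag_polForm_herm n k A hA]
    exact mul_ne_zero (by exact_mod_cast Nat.factorial_ne_zero k) (esum_ne_zero n k hkn _ z hz)

end concrete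

/-- Garding: if `A₁,...,A_k` are symmetric with eigenvalues in `Γₖ⁺`, then
`Σ_k(A₁,...,A_k) > 0`. -/
theorem polSigma_pos (n k : ℕ) (hk : 1 ≤ k) (hkn : k ≤ n)
    (A : Fin k → Matrix (Fin n) (Fin n) ℝ) (hA : ∀ a, (A a).IsHermitian)
    (hcone : ∀ a, inGamma n k (hA a).eigenvalues) :
    0 < polSigma n k A := by
  have h := garding_pos k (polForm n k) (polForm_hyp n k hkn)
    (fun a => (A a).map Complex.ofReal) (fun a => polForm_cone n k hk hkn (A a) (hA a) (hcone a))
  rw [polForm_ofReal, Complex.ofReal_re] at h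
  unfold polSigma
  positivity
end

section
/- If A₁, ..., A_k are symmetric n×n matrices each with eigenvalues in Γ_{k+1}⁺, then the polarized Newton transformation tensor [Tₖ](A₁,...,A_k) is a positive definite matrix. -/
open Equiv
open scoped Matrix

/-- mixed form -/
def MM {R : Type*} [CommRing R] {n m : ℕ} (B : Fin m → Matrix (Fin n) (Fin n) R) : R :=
  ∑ i : Fin m → Fin n, ∑ σ : Perm (Fin m), ((Perm.sign σ : ℤ) : R) * ∏ a, B a (i a) (i (σ a))

lemma MM_map {R S : Type*} [CommRing R] [CommRing S] (f : R →+* S) {n m : ℕ}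
    (B : Fin m → Matrix (Fin n) (Fin n) R) : MM (fun a => (B a).map f) = f (MM B) := by
  simp [MM, map_sum, map_prod]

lemma MM_perm {R : Type*} [CommRing R] {n m : ℕ} (B : Fin m → Matrix (Fin n) (Fin n) R)
    (π : Perm (Fin m)) : MM (fun a => B (π a)) = MM B := by
  unfold MM
  refine Fintype.sum_equiv (π.arrowCongr (Equiv.refl _)) _ _ fun i => ?_
  refine Fintype.sum_equiv (MulAut.conj π).toEquiv _ _ fun σ => ?_
  have h1 : Perm.sign ((MulAut.conj π).toEquiv σ) = Perm.sign σ := by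
    simp [MulAut.conj_apply, mul_comm]
    rw [← mul_assoc, Int.units_mul_self, one_mul]
  rw [h1]
  congr 1
  refine Fintype.prod_equiv π _ _ fun a => ?_
  simp [Equiv.arrowCongr, MulAut.conj_apply]

lemma MM_smul {R : Type*} [CommRing R] {n m : ℕ} (B : Fin m → Matrix (Fin n) (Fin n) R)
    (c : R) : MM (fun a => c • B a) = c ^ m * MM B := by
  unfold MM
  simp only [Finset.mul_sum, Matrix.smul_apply, smul_eq_mul, Finset.prod_mul_distrib]
  refine Finset.sum_congr rfl fun i _ => Finset.sum_congr rfl fun σ _ => ?_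
  simp; ring

lemma MM_update_add {R : Type*} [CommRing R] {n m : ℕ} (B : Fin m → Matrix (Fin n) (Fin n) R)
    (b : Fin m) (X Y : Matrix (Fin n) (Fin n) R) (c : R) :
    MM (Function.update B b (X + c • Y)) =
      MM (Function.update B b X) + c * MM (Function.update B b Y) := by
  unfold MM
  simp only [Finset.mul_sum, ← Finset.sum_add_distrib]
  refine Finset.sum_congr rfl fun i _ => Finset.sum_congr rfl fun σ _ => ?_
  have key : ∀ Z, ∏ a, Function.update B b Z a (i a) (i (σ a)) =
      Z (i b) (i (σ b)) * ∏ a ∈ Finset.univ.erase b, B a (i a) (i (σ a)) := by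
    intro Z
    rw [← Finset.mul_prod_erase _ _ (Finset.mem_univ b)]
    congr 1
    · simp
    · refine Finset.prod_congr rfl fun a ha => ?_
      rw [Function.update_of_ne (Finset.ne_of_mem_erase ha)]
  simp only [key, Matrix.add_apply, Matrix.smul_apply, smul_eq_mul]
  ring

lemma MM_conj {R : Type*} [CommRing R] {n m : ℕ} (B : Fin m → Matrix (Fin n) (Fin n) R)
    (U V : Matrix (Fin n) (Fin n) R) (h : V * U = 1) :
    MM (fun a => U * B a * V) = MM B := by
  have hVU : ∀ p q, ∑ x, V p x * U x q = if p = q then 1 else 0 := by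
    intro p q
    rw [← Matrix.mul_apply, h, Matrix.one_apply]
  unfold MM
  rw [Finset.sum_comm]
  conv_rhs => rw [Finset.sum_comm]
  refine Finset.sum_congr rfl fun σ _ => ?_
  rw [← Finset.mul_sum, ← Finset.mul_sum]
  congr 1
  have e1 : ∀ i : Fin m → Fin n, ∏ a, (U * B a * V) (i a) (i (σ a)) =
      ∑ p : Fin m → Fin n, ∑ q : Fin m → Fin n,
        (∏ a, B a (p a) (q a)) * ∏ a, (V (q (σ⁻¹ a)) (i a) * U (i a) (p a)) := by
    intro i
    have : ∀ a, (U * B a * V) (i a) (i (σ a)) =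
        ∑ p, ∑ q, U (i a) p * B a p q * V q (i (σ a)) := by
      intro a
      simp only [Matrix.mul_apply, Finset.sum_mul]
      exact Finset.sum_comm
    simp only [this]
    rw [Fintype.prod_sum]
    refine Finset.sum_congr rfl fun p _ => ?_
    rw [Fintype.prod_sum]
    refine Finset.sum_congr rfl fun q _ => ?_
    simp only [Finset.prod_mul_distrib]
    have : ∏ a, V (q (σ⁻¹ a)) (i a) = ∏ a, V (q a) (i (σ a)) := by
      refine (Fintype.prod_equiv σ _ _ fun a => ?_).symm
      simp
    rw [this]; ring
  simp only [e1]
  rw [Finset.sum_comm]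
  refine Finset.sum_congr rfl fun p _ => ?_
  rw [Finset.sum_comm]
  simp only [← Finset.mul_sum]
  have e2 : ∀ q : Fin m → Fin n,
      ∑ i : Fin m → Fin n, ∏ a, (V (q (σ⁻¹ a)) (i a) * U (i a) (p a)) =
       if q = fun a => p (σ a) then 1 else 0 := by
    intro q
    rw [← Fintype.prod_sum (fun a x => V (q (σ⁻¹ a)) x * U x (p a))]
    simp only [hVU]
    rw [Finset.prod_ite_zero]
    simp only [Finset.prod_const_one]
    congr 1
    simp only [Finset.mem_univ, true_imp_iff, funext_iff, eq_iff_iff]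
    constructor
    · intro h a; simpa using h (σ a)
    · intro h a; simpa using h (σ⁻¹ a)
  simp only [e2]
  simp

lemma MM_diag {R : Type*} [CommRing R] {n m : ℕ} (d : Fin n → R) :
    MM (fun _ : Fin m => Matrix.diagonal d) =
      (m.factorial : R) * ∑ s ∈ Finset.powersetCard m (Finset.univ : Finset (Fin n)), ∏ i ∈ s, d i := by
  classical
  have e1 : ∀ i : Fin m → Fin n, ∑ σ : Perm (Fin m), ((Perm.sign σ : ℤ) : R) *
      ∏ a, (Matrix.diagonal d) (i a) (i (σ a)) = if Function.Injective i then ∏ a, d (i a) else 0 := by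
    intro i
    have : ∑ σ : Perm (Fin m), ((Perm.sign σ : ℤ) : R) *
      ∏ a, (Matrix.diagonal d) (i a) (i (σ a)) = (Matrix.transpose ((Matrix.diagonal d).submatrix i i)).det := by
      rw [Matrix.det_apply']; simp
    rw [this, Matrix.det_transpose]
    split_ifs with h
    · rw [Matrix.submatrix_diagonal _ _ h, Matrix.det_diagonal]; rfl
    · simp only [Function.Injective, not_forall] at h
      obtain ⟨a, b, hab, hne⟩ := h
      exact Matrix.det_zero_of_row_eq hne (by ext c; simp [hab])
  unfold MM
  simp only [e1]
  rw [← Finset.sum_filter, Finset.mul_sum]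
  rw [← Finset.sum_fiberwise_of_maps_to (s := Finset.univ.filter fun i : Fin m → Fin n => Function.Injective i)
    (t := Finset.powersetCard m (Finset.univ : Finset (Fin n))) (g := fun i => Finset.univ.image i)]
  · refine Finset.sum_congr rfl fun s hs => ?_
    rw [Finset.mem_powersetCard] at hs
    rw [Finset.sum_congr rfl (g := fun _ => ∏ i ∈ s, d i)]
    · rw [Finset.sum_const, nsmul_eq_mul]
      congr 2
      have : (m.factorial) = Fintype.card (Fin m ≃ s) := by
        rw [Fintype.card_equiv (Fintype.equivOfCardEq (by simp [hs.2]))]; simp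
      rw [this, ← Finset.card_univ]
      symm
      refine Finset.card_bij (fun e _ a => (e a : Fin n)) ?_ ?_ ?_
      · intro e _
        simp only [Finset.mem_filter, Finset.mem_univ, true_and]
        refine ⟨fun a b h => e.injective (Subtype.ext h), ?_⟩
        ext x
        simp only [Finset.mem_image, Finset.mem_univ, true_and]
        constructor
        · rintro ⟨a, rfl⟩; exact (e a).2
        · intro hx; exact ⟨e.symm ⟨x, hx⟩, by simp⟩
      · intro e _ f _ h
        ext a; exact congrArg Fin.val (congrFun h a)
      · intro i hi
        simp only [Finset.mem_filter, Finset.mem_univ, true_and] at hi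
        obtain ⟨h1, h2⟩ := hi
        have hm : ∀ a, i a ∈ s := fun a => by rw [← h2]; simp
        refine ⟨Equiv.ofBijective (fun a => (⟨i a, hm a⟩ : s)) ⟨?_, ?_⟩, Finset.mem_univ _, rfl⟩
        · intro a b h; exact h1 (congrArg Subtype.val h)
        · rintro ⟨x, hx⟩
          rw [← h2] at hx
          obtain ⟨a, _, ha⟩ := Finset.mem_image.1 hx
          exact ⟨a, Subtype.ext ha⟩
    · intro i hi
      simp only [Finset.mem_filter, Finset.mem_univ, true_and] at hi
      rw [← hi.2, Finset.prod_image (fun a _ b _ h => hi.1 h)]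
  · intro i hi
    simp only [Finset.mem_filter, Finset.mem_univ, true_and] at hi
    simp [Finset.mem_powersetCard, Finset.card_image_of_injective _ hi]


/-- power form -/
def pp {R : Type*} [CommRing R] {n : ℕ} (m : ℕ) (Z : Matrix (Fin n) (Fin n) R) : R :=
  MM (fun _ : Fin m => Z)

lemma pp_smul {R : Type*} [CommRing R] {n m : ℕ} (Z : Matrix (Fin n) (Fin n) R) (c : R) :
    pp m (c • Z) = c ^ m * pp m Z := MM_smul _ c

lemma pp_map {R S : Type*} [CommRing R] [CommRing S] (f : R →+* S) {n m : ℕ}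
    (Z : Matrix (Fin n) (Fin n) R) : pp m (Z.map f) = f (pp m Z) := MM_map f _

lemma pp_spectral {R : Type*} [CommRing R] (f : ℝ →+* R) {n m : ℕ}
    {A : Matrix (Fin n) (Fin n) ℝ} (hA : A.IsHermitian) (t : R) :
    pp m (A.map f + t • (1 : Matrix (Fin n) (Fin n) R)) = (m.factorial : R) *
      ∑ s ∈ Finset.powersetCard m (Finset.univ : Finset (Fin n)), ∏ i ∈ s, (f (hA.eigenvalues i) + t) := by
  have h := hA.spectral_theorem
  rw [Unitary.conjStarAlgAut_apply] at h
  set U : Matrix (Fin n) (Fin n) ℝ := hA.eigenvectorUnitary.val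
  have hU : star U * U = 1 := Unitary.coe_star_mul_self hA.eigenvectorUnitary
  have hU' : U * star U = 1 := Unitary.coe_mul_star_self hA.eigenvectorUnitary
  have h1 : (star U).map f * U.map f = 1 := by
    rw [← Matrix.map_mul, hU]; simp
  have h2 : U.map f * (star U).map f = 1 := by
    rw [← Matrix.map_mul, hU']; simp
  have h3 : A.map f + t • (1 : Matrix (Fin n) (Fin n) R) =
      U.map f * (Matrix.diagonal fun i => f (hA.eigenvalues i) + t) * (star U).map f := by
    have : (Matrix.diagonal fun i => f (hA.eigenvalues i) + t) =
        (Matrix.diagonal fun i => f (hA.eigenvalues i)) + t • (1 : Matrix (Fin n) (Fin n) R) := by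
      rw [Matrix.smul_one_eq_diagonal, Matrix.diagonal_add]
    rw [this, mul_add, add_mul]
    congr 1
    · conv_lhs => rw [h]
      rw [Matrix.map_mul, Matrix.map_mul, Matrix.diagonal_map (map_zero f)]
      rfl
    · simp [h2]
  rw [h3]
  unfold pp
  rw [MM_conj _ _ _ h1, MM_diag]

lemma esum_coeff {R : Type*} [CommRing R] {n m : ℕ} (hm : m ≤ n) (d : Fin n → R) :
    ∑ s ∈ Finset.powersetCard m (Finset.univ : Finset (Fin n)), ∏ i ∈ s, d i =
    (∏ i, (Polynomial.X + Polynomial.C (d i))).coeff (n - m) := by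
  rw [Finset.prod_X_add_C_coeff _ _ (by simp)]
  simp [Nat.sub_sub_self hm]

lemma esum_pos_s13 {n m : ℕ} (hm : m ≤ n) (d : Fin n → ℝ) 
    (h : ∀ j, 1 ≤ j → j ≤ m → 0 < ∑ s ∈ Finset.powersetCard j (Finset.univ : Finset (Fin n)), ∏ i ∈ s, d i)
    (w : ℝ) (hw : 0 ≤ w) :
    0 < ∑ s ∈ Finset.powersetCard m (Finset.univ : Finset (Fin n)), ∏ i ∈ s, (d i + w) := by
  have h' : ∀ j, j ≤ m → 0 < ∑ s ∈ Finset.powersetCard j (Finset.univ : Finset (Fin n)), ∏ i ∈ s, d i := by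
    intro j hj
    rcases Nat.eq_zero_or_pos j with rfl | h0
    · simp
    · exact h j h0 hj
  rw [esum_coeff hm]
  have e : ∏ i, (Polynomial.X + Polynomial.C (d i + w)) =
      Polynomial.taylor w (∏ i, (Polynomial.X + Polynomial.C (d i))) := by
    rw [Polynomial.taylor_apply, Polynomial.prod_comp]
    refine Finset.prod_congr rfl fun i _ => ?_
    simp; ring
  set f : Polynomial ℝ := ∏ i, (Polynomial.X + Polynomial.C (d i)) with hf
  have hdeg : f.natDegree = n := by
    rw [hf, Polynomial.natDegree_prod_of_monic _ _ fun i _ => Polynomial.monic_X_add_C _]; simp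
  rw [e, Polynomial.taylor_coeff, Polynomial.eval_eq_sum_range' (n := m + 1)]
  · have hc : ∀ i ∈ Finset.range (m + 1), 0 < (Polynomial.hasseDeriv (n - m) f).coeff i := by
      intro i hi
      have hi' : i ≤ m := by simpa [Nat.lt_succ_iff] using hi
      rw [Polynomial.hasseDeriv_coeff]
      have := h' (m - i) (by omega)
      rw [esum_coeff (by omega)] at this
      have e : n - (m - i) = i + (n - m) := by omega
      rw [e] at this
      refine mul_pos ?_ this
      exact_mod_cast Nat.choose_pos (by omega)
    refine Finset.sum_pos' (fun i hi => mul_nonneg (hc i hi).le (pow_nonneg hw i)) ⟨0, by simp, ?_⟩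
    simpa using hc 0 (by simp)
  · have := Polynomial.natDegree_hasseDeriv_le f (n - m)
    omega

lemma gauss_lucas_im (f : Polynomial ℂ) (hf : 0 < f.natDegree)
    (h : ∀ z : ℂ, 0 ≤ z.im → f.eval z ≠ 0) (z : ℂ) (hz : 0 ≤ z.im) : f.derivative.eval z ≠ 0 := by
  intro h0
  have hne : f.derivative ≠ 0 := by
    intro h1
    have := Polynomial.derivative_eq_zero.1 h1
    omega
  have h1 := Polynomial.rootSet_derivative_subset_convexHull_rootSet
    (Polynomial.natDegree_pos_iff_degree_pos.1 hf) (a := z) (by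
      rw [Polynomial.mem_rootSet]; exact ⟨hne, by simpa using h0⟩)
  have h2 : convexHull ℝ (f.rootSet ℂ) ⊆ {z | z.im < 0} := by
    refine convexHull_min ?_ (convex_halfSpace_im_lt 0)
    intro x hx
    rw [Polynomial.mem_rootSet] at hx
    by_contra hc
    exact h x (not_lt.1 hc) (by simpa using hx.2)
  have := h2 h1
  simp at this; linarith

lemma esum_ne {n m : ℕ} (hm : m ≤ n) (d : Fin n → ℂ) (hd : ∀ i, 0 < (d i).im) :
    ∑ s ∈ Finset.powersetCard m (Finset.univ : Finset (Fin n)), ∏ i ∈ s, d i ≠ 0 := by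
  rw [esum_coeff hm]
  set f : Polynomial ℂ := ∏ i, (Polynomial.X + Polynomial.C (d i)) with hf
  have hdeg : f.natDegree = n := by
    rw [hf, Polynomial.natDegree_prod_of_monic _ _ fun i _ => Polynomial.monic_X_add_C _]; simp
  have hz : ∀ z : ℂ, 0 ≤ z.im → f.eval z ≠ 0 := by
    intro z hz
    rw [hf, Polynomial.eval_prod, Finset.prod_ne_zero_iff]
    intro i _ h
    have := congrArg Complex.im h
    simp at this
    have := hd i
    linarith
  have key : ∀ r, r ≤ n → (Polynomial.derivative^[r] f).natDegree = n - r ∧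
      ∀ z : ℂ, 0 ≤ z.im → (Polynomial.derivative^[r] f).eval z ≠ 0 := by
    intro r
    induction r with
    | zero => intro _; exact ⟨by simp [hdeg], by simpa using hz⟩
    | succ r ih =>
      intro hr
      obtain ⟨h1, h2⟩ := ih (by omega)
      rw [Function.iterate_succ_apply']
      refine ⟨?_, gauss_lucas_im _ (by omega) h2⟩
      rw [Polynomial.natDegree_derivative, h1]; omega
  have h1 := (key (n - m) (by omega)).2 0 (by simp)
  rw [← Polynomial.coeff_zero_eq_eval_zero, Polynomial.coeff_iterate_derivative] at h1
  intro h0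
  apply h1
  simp [h0]

/-- the real matrix as complex matrix -/
abbrev cm {n : ℕ} (A : Matrix (Fin n) (Fin n) ℝ) : Matrix (Fin n) (Fin n) ℂ := A.map Complex.ofRealHom

lemma pp_base {n m : ℕ} (hm : m ≤ n) {X : Matrix (Fin n) (Fin n) ℝ} (hX : X.IsHermitian) (v : ℝ)
    (hv : v ≠ 0) : pp m (cm X + ((v : ℂ) * Complex.I) • (1 : Matrix (Fin n) (Fin n) ℂ)) ≠ 0 := by
  have main : ∀ {X : Matrix (Fin n) (Fin n) ℝ} (hX : X.IsHermitian) (v : ℝ), 0 < v →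
      pp m (cm X + ((v : ℂ) * Complex.I) • (1 : Matrix (Fin n) (Fin n) ℂ)) ≠ 0 := by
    intro X hX v hv
    rw [pp_spectral Complex.ofRealHom hX]
    refine mul_ne_zero (by exact_mod_cast m.factorial_ne_zero) (esum_ne hm _ fun i => ?_)
    simpa using hv
  rcases lt_or_gt_of_ne hv with h | h
  · have := main hX.neg (-v) (by linarith)
    intro h0
    apply this
    have e : cm (-X) + (((-v : ℝ) : ℂ) * Complex.I) • (1 : Matrix (Fin n) (Fin n) ℂ) =
      (-1 : ℂ) • (cm X + ((v : ℂ) * Complex.I) • (1 : Matrix (Fin n) (Fin n) ℂ)) := by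
      ext i j; simp; ring
    rw [e, pp_smul, h0, mul_zero]
  · exact main hX v h


lemma clopen_disc (F : ℝ → ℂ → ℂ) (hF : Continuous (Function.uncurry F))
    (hd : ∀ s, Differentiable ℂ (F s))
    (hb : ∀ s ∈ Set.Icc (0:ℝ) 1, ∀ z : ℂ, ‖z‖ = 1 → F s z ≠ 0)
    (h0 : ∀ z : ℂ, ‖z‖ ≤ 1 → F 0 z ≠ 0) (z : ℂ) (hz : ‖z‖ ≤ 1) : F 1 z ≠ 0 := by
  have hK : IsCompact (Metric.closedBall (0:ℂ) 1) := isCompact_closedBall 0 1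
  -- uniform lower bound on the boundary
  obtain ⟨δ, hδ, hδb⟩ : ∃ δ > 0, ∀ s ∈ Set.Icc (0:ℝ) 1, ∀ z : ℂ, ‖z‖ = 1 → δ ≤ ‖F s z‖ := by
    have hc : IsCompact (Set.Icc (0:ℝ) 1 ×ˢ Metric.sphere (0:ℂ) 1) :=
      isCompact_Icc.prod (isCompact_sphere 0 1)
    obtain ⟨x, hx, hmin⟩ := hc.exists_isMinOn ⟨(0, 1), by simp⟩ (hF.norm.continuousOn)
    refine ⟨‖F x.1 x.2‖, norm_pos_iff.2 (hb _ hx.1 _ (by simpa using hx.2)), ?_⟩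
    intro s hs z hz
    exact hmin (a := (s, z)) ⟨hs, by simpa using hz⟩
  have hgood : ∀ s ∈ Set.Icc (0:ℝ) 1, (∀ z : ℂ, ‖z‖ ≤ 1 → F s z ≠ 0) →
      ∀ z : ℂ, ‖z‖ ≤ 1 → δ ≤ ‖F s z‖ := by
    intro s hs hne z hz
    have hcl : closure (Metric.ball (0:ℂ) 1) = Metric.closedBall 0 1 := closure_ball _ one_ne_zero
    have := Complex.norm_le_of_forall_mem_frontier_norm_le (f := fun z => (F s z)⁻¹)
      (U := Metric.ball (0:ℂ) 1) Metric.isBounded_ball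
      ((hd s).diffContOnCl.inv (by rw [hcl]; intro z hz; exact hne z (by simpa using hz)))
      (C := δ⁻¹) (by
        rw [frontier_ball _ one_ne_zero]
        intro z hz
        rw [norm_inv]
        exact inv_anti₀ hδ (hδb s hs z (by simpa using hz))) (z := z) (by rw [hcl]; simpa using hz)
    rw [norm_inv] at this
    exact (inv_le_inv₀ (norm_pos_iff.2 (hne z hz)) hδ).1 this
  set φ : ℝ → ℝ := fun s => sInf ((fun z => ‖F s z‖) '' Metric.closedBall (0:ℂ) 1) with hφ
  have hφc : Continuous φ := hK.continuous_sInf (f := fun s z => ‖F s z‖) hF.norm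
  have hne : ∀ s, ((fun z => ‖F s z‖) '' Metric.closedBall (0:ℂ) 1).Nonempty := fun s =>
    ⟨_, 0, by simp, rfl⟩
  have hbdd : ∀ s, BddBelow ((fun z => ‖F s z‖) '' Metric.closedBall (0:ℂ) 1) := fun s =>
    ⟨0, by rintro _ ⟨z, _, rfl⟩; exact norm_nonneg _⟩
  have hle : ∀ s, ∀ z : ℂ, ‖z‖ ≤ 1 → φ s ≤ ‖F s z‖ := fun s z hz =>
    csInf_le (hbdd s) ⟨z, by simpa using hz, rfl⟩
  have hφg : ∀ s ∈ Set.Icc (0:ℝ) 1, (∀ z : ℂ, ‖z‖ ≤ 1 → F s z ≠ 0) → δ ≤ φ s := by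
    intro s hs h
    refine le_csInf (hne s) ?_
    rintro _ ⟨z, hz, rfl⟩
    exact hgood s hs h z (by simpa using hz)
  intro hzero
  have h1 : φ 1 ≤ 0 := by simpa [hzero] using hle 1 z hz
  have h2 : δ ≤ φ 0 := hφg 0 (by simp) h0
  obtain ⟨s, hs, hse⟩ := intermediate_value_Icc' (zero_le_one (α := ℝ)) hφc.continuousOn
    (show δ / 2 ∈ Set.Icc (φ 1) (φ 0) from ⟨by linarith, by linarith⟩)
  have : δ ≤ φ s := hφg s hs fun z hz h => by
    have := hle s z hz
    rw [h, norm_zero] at this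
    linarith
  linarith

/-- The cone. -/
def Cn {n : ℕ} (m : ℕ) (A : Matrix (Fin n) (Fin n) ℝ) : Prop :=
  A.IsHermitian ∧ ∀ w : ℝ, 0 ≤ w → 0 < pp m (A + w • (1 : Matrix (Fin n) (Fin n) ℝ))

lemma pp_cm {n m : ℕ} (A : Matrix (Fin n) (Fin n) ℝ) : pp m (cm A) = ((pp m A : ℝ) : ℂ) :=
  pp_map Complex.ofRealHom A

section
variable {n m : ℕ}

lemma Cn.pos {A : Matrix (Fin n) (Fin n) ℝ} (h : Cn m A) : 0 < pp m A := by
  simpa using h.2 0 le_rfl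

lemma Cn.add_one {A : Matrix (Fin n) (Fin n) ℝ} (h : Cn m A) (w : ℝ) (hw : 0 ≤ w) :
    Cn m (A + w • (1 : Matrix (Fin n) (Fin n) ℝ)) := by
  refine ⟨h.1.add (by simp [Matrix.IsHermitian]), fun v hv => ?_⟩
  rw [add_assoc, ← add_smul]
  exact h.2 _ (by linarith)

lemma Cn.smul {A : Matrix (Fin n) (Fin n) ℝ} (h : Cn m A) (c : ℝ) (hc : 0 < c) :
    Cn m (c • A) := by
  refine ⟨by have := h.1; simp only [Matrix.IsHermitian, Matrix.conjTranspose_smul] at *; rw [this]; simp, fun v hv => ?_⟩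
  have : c • A + v • (1 : Matrix (Fin n) (Fin n) ℝ) = c • (A + (v / c) • (1 : Matrix (Fin n) (Fin n) ℝ)) := by
    rw [smul_add, smul_smul]; congr 2; field_simp
  rw [this, pp_smul]
  exact mul_pos (pow_pos hc _) (h.2 _ (by positivity))

lemma Cn.sub_one {A : Matrix (Fin n) (Fin n) ℝ} (h : Cn m A) :
    ∃ ε : ℝ, 0 < ε ∧ Cn m (A - ε • (1 : Matrix (Fin n) (Fin n) ℝ)) := by
  have hc : Continuous fun w : ℝ => pp m (A + w • (1 : Matrix (Fin n) (Fin n) ℝ)) := by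
    unfold pp MM; simp only [Matrix.add_apply, Matrix.smul_apply]; fun_prop
  have : ∀ᶠ w in nhds (0:ℝ), 0 < pp m (A + w • (1 : Matrix (Fin n) (Fin n) ℝ)) :=
    hc.continuousAt.eventually (lt_mem_nhds (h.2 0 le_rfl))
  obtain ⟨r, hr, hball⟩ := Metric.eventually_nhds_iff.1 this
  refine ⟨r / 2, by positivity, h.1.sub (by simp [Matrix.IsHermitian]), fun w hw => ?_⟩
  have e : A - (r / 2) • (1 : Matrix (Fin n) (Fin n) ℝ) + w • (1 : Matrix (Fin n) (Fin n) ℝ) =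
      A + (w - r / 2) • (1 : Matrix (Fin n) (Fin n) ℝ) := by
    rw [_root_.sub_smul]; abel
  rw [e]
  by_cases h1 : 0 ≤ w - r / 2
  · exact h.2 _ h1
  · apply hball
    rw [Real.dist_eq, sub_zero, abs_of_neg (not_le.1 h1)]
    linarith

lemma pp_one_pos (hm : m ≤ n) (t : ℝ) (ht : 0 < t) : 0 < pp m (t • (1 : Matrix (Fin n) (Fin n) ℝ)) := by
  rw [Matrix.smul_one_eq_diagonal]
  unfold pp
  rw [MM_diag]
  refine mul_pos (by exact_mod_cast m.factorial_pos) (Finset.sum_pos (fun s _ => Finset.prod_pos fun _ _ => ht) ?_)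
  exact Finset.powersetCard_nonempty.2 (by simpa using hm)

lemma pp_psd (hm : m ≤ n) {A : Matrix (Fin n) (Fin n) ℝ} (hA : A.PosSemidef) (t : ℝ) (ht : 0 < t) :
    Cn m (A + t • (1 : Matrix (Fin n) (Fin n) ℝ)) := by
  refine ⟨hA.1.add (by simp [Matrix.IsHermitian]), fun v hv => ?_⟩
  rw [add_assoc, ← add_smul]
  have := pp_spectral (m := m) (RingHom.id ℝ) hA.1 (t + v)
  simp only [RingHom.id_apply] at this
  rw [show A.map (RingHom.id ℝ) = A by ext; simp] at this
  rw [this]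
  refine mul_pos (by exact_mod_cast m.factorial_pos) (Finset.sum_pos (fun s _ => Finset.prod_pos fun i _ => ?_) ?_)
  · have := hA.eigenvalues_nonneg i
    linarith
  · exact Finset.powersetCard_nonempty.2 (by simpa using hm)

lemma Cn_one (hm : m ≤ n) : Cn m (1 : Matrix (Fin n) (Fin n) ℝ) := by
  simpa using pp_psd hm (Matrix.PosSemidef.zero) 1 one_pos

/-- real matrix + w I, w in the closed right half plane -/
lemma pp_rhp (hm : m ≤ n) {A : Matrix (Fin n) (Fin n) ℝ} (h : Cn m A) (w : ℂ) (hw : 0 ≤ w.re) :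
    pp m (cm A + w • (1 : Matrix (Fin n) (Fin n) ℂ)) ≠ 0 := by
  by_cases hi : w.im = 0
  · have e : cm A + w • (1 : Matrix (Fin n) (Fin n) ℂ) = cm (A + w.re • (1 : Matrix (Fin n) (Fin n) ℝ)) := by
      have : w = (w.re : ℂ) := Complex.ext (by simp) (by simpa using hi)
      rw [this]
      ext i j; simp [Matrix.one_apply]; split_ifs <;> simp
    rw [e, pp_cm]
    exact_mod_cast (h.2 _ hw).ne'
  · have e : cm A + w • (1 : Matrix (Fin n) (Fin n) ℂ) =
        cm (A + w.re • (1 : Matrix (Fin n) (Fin n) ℝ)) + ((w.im : ℂ) * Complex.I) • (1 : Matrix (Fin n) (Fin n) ℂ) := by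
      ext i j
      by_cases hij : i = j
      · subst hij; simp [add_assoc]
      · simp [hij]
    rw [e]
    exact pp_base hm (h.1.add (by simp [Matrix.IsHermitian])) _ hi

lemma cayley_re (z : ℂ) (hz : ‖z‖ ≤ 1) : 0 ≤ ((1 + z) / (1 - z)).re := by
  have : Complex.normSq z ≤ 1 := by
    rw [Complex.normSq_eq_norm_sq]; nlinarith [norm_nonneg z]
  rw [Complex.div_re, ← add_div]
  apply div_nonneg _ (Complex.normSq_nonneg _)
  rw [Complex.normSq_apply] at this
  simp; nlinarith

lemma cayley_re' (z : ℂ) (hz : ‖z‖ = 1) : ((1 + z) / (1 - z)).re = 0 := by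
  have : Complex.normSq z = 1 := by
    rw [Complex.normSq_eq_norm_sq, hz]; simp
  rw [Complex.div_re, ← add_div]
  rw [Complex.normSq_apply] at this
  rw [div_eq_zero_iff]; left
  simp; nlinarith

/-- homogeneous version -/
lemma pp_rhp_h (hm : m ≤ n) {A : Matrix (Fin n) (Fin n) ℝ} (h : Cn m A) (z : ℂ) (hz : ‖z‖ ≤ 1) :
    pp m ((1 - z) • cm A + (1 + z) • (1 : Matrix (Fin n) (Fin n) ℂ)) ≠ 0 := by
  by_cases h1 : z = 1
  · subst h1
    have e : ((1:ℂ) - 1) • cm A + ((1:ℂ) + 1) • (1 : Matrix (Fin n) (Fin n) ℂ) = cm ((2:ℝ) • (1 : Matrix (Fin n) (Fin n) ℝ)) := by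
      ext i j; simp [Matrix.one_apply]; split_ifs <;> norm_num
    rw [e, pp_cm]
    exact_mod_cast (pp_one_pos hm 2 two_pos).ne'
  · have h1' : 1 - z ≠ 0 := sub_ne_zero.2 (Ne.symm h1)
    have e : (1 - z) • cm A + (1 + z) • (1 : Matrix (Fin n) (Fin n) ℂ) =
        (1 - z) • (cm A + ((1 + z) / (1 - z)) • (1 : Matrix (Fin n) (Fin n) ℂ)) := by
      rw [smul_add, smul_smul, mul_div_cancel₀ _ h1']
    rw [e, pp_smul]
    exact mul_ne_zero (pow_ne_zero _ h1') (pp_rhp hm h _ (cayley_re z hz))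

lemma stab_aux (hm : m ≤ n) {A X : Matrix (Fin n) (Fin n) ℝ} (h : Cn m A) (hX : X.IsHermitian)
    (u : ℝ) (hu : 0 ≤ u) :
    pp m (cm X + Complex.I • cm (1 + u • A)) ≠ 0 := by
  have key := clopen_disc (fun s z => pp m ((1 - z) • ((s : ℂ) • cm X + Complex.I • (1 : Matrix (Fin n) (Fin n) ℂ))
      + (Complex.I * (1 + z)) • cm A)) ?_ ?_ ?_ ?_ (((u - 1) / (u + 1) : ℝ) : ℂ) ?_
  · intro h0
    apply key
    have e : ((1:ℂ) - (((u - 1) / (u + 1) : ℝ) : ℂ)) • (((1:ℝ) : ℂ) • cm X + Complex.I • (1 : Matrix (Fin n) (Fin n) ℂ))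
      + (Complex.I * (1 + (((u - 1) / (u + 1) : ℝ) : ℂ))) • cm A = ((2 / (u + 1) : ℝ) : ℂ) • (cm X + Complex.I • cm (1 + u • A)) := by
      have hu1 : (u : ℂ) + 1 ≠ 0 := by exact_mod_cast (by linarith : u + 1 ≠ 0)
      ext i j; simp [Matrix.one_apply]; split_ifs <;> simp <;> field_simp <;> ring
    rw [e, pp_smul, h0, mul_zero]
  · unfold pp MM Function.uncurry; simp only [Matrix.add_apply, Matrix.smul_apply]; fun_prop
  · intro s
    unfold pp MM; simp only [Matrix.add_apply, Matrix.smul_apply, smul_eq_mul]; fun_prop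
  · intro s hs z hz
    by_cases h1 : z = 1
    · subst h1
      have e : (1 - (1:ℂ)) • ((s : ℂ) • cm X + Complex.I • (1 : Matrix (Fin n) (Fin n) ℂ))
        + (Complex.I * (1 + 1)) • cm A = (2 * Complex.I) • cm A := by
        simp; congr 1; ring
      simp only [e, pp_smul, pp_cm]
      exact mul_ne_zero (by simp) (by exact_mod_cast h.pos.ne')
    · have h1' : 1 - z ≠ 0 := sub_ne_zero.2 (Ne.symm h1)
      have hr := cayley_re' z hz
      obtain ⟨r, hr⟩ : ∃ r : ℝ, Complex.I * (1 + z) = (1 - z) * r := by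
        refine ⟨-((1 + z) / (1 - z)).im, ?_⟩
        have : (1 + z) / (1 - z) = (((1 + z) / (1 - z)).im : ℂ) * Complex.I := by
          apply Complex.ext <;> simp [hr]
        rw [div_eq_iff h1'] at this
        push_cast; linear_combination Complex.I * this + (((1 + z) / (1 - z)).im : ℂ) * (1 - z) * Complex.I_mul_I
      have e : (1 - z) • ((s : ℂ) • cm X + Complex.I • (1 : Matrix (Fin n) (Fin n) ℂ))
        + (Complex.I * (1 + z)) • cm A = (1 - z) • (cm (s • X + r • A) + (((1:ℝ) : ℂ) * Complex.I) • (1 : Matrix (Fin n) (Fin n) ℂ)) := by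
        rw [hr]; ext i j; simp; ring
      simp only [e, pp_smul]
      refine mul_ne_zero (pow_ne_zero _ h1') (pp_base hm ?_ 1 one_ne_zero)
      exact (hX.smul (IsSelfAdjoint.all s)).add (h.1.smul (IsSelfAdjoint.all r))
  · intro z hz
    have e : (1 - z) • (((0:ℝ) : ℂ) • cm X + Complex.I • (1 : Matrix (Fin n) (Fin n) ℂ))
        + (Complex.I * (1 + z)) • cm A = Complex.I • ((1 - (-z)) • cm A + (1 + (-z)) • (1 : Matrix (Fin n) (Fin n) ℂ)) := by
      ext i j; simp; ring
    simp only [e, pp_smul]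
    exact mul_ne_zero (by simp) (pp_rhp_h hm h (-z) (by simpa using hz))
  · rw [Complex.norm_real, Real.norm_eq_abs, abs_le, le_div_iff₀ (by linarith), div_le_iff₀ (by linarith)]
    constructor <;> linarith

lemma stab (hm : m ≤ n) {A X : Matrix (Fin n) (Fin n) ℝ} (h : Cn m A) (hX : X.IsHermitian) :
    pp m (cm X + Complex.I • cm A) ≠ 0 := by
  obtain ⟨ε, hε, h'⟩ := h.sub_one
  have := stab_aux hm h' (hX.smul (IsSelfAdjoint.all (ε⁻¹))) ε⁻¹ (by positivity)
  intro h0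
  apply this
  have e : cm (ε⁻¹ • X) + Complex.I • cm (1 + ε⁻¹ • (A - ε • (1 : Matrix (Fin n) (Fin n) ℝ))) = (ε⁻¹ : ℂ) • (cm X + Complex.I • cm A) := by
    have : ε⁻¹ • (A - ε • (1 : Matrix (Fin n) (Fin n) ℝ)) = ε⁻¹ • A - 1 := by
      rw [smul_sub, smul_smul, inv_mul_cancel₀ hε.ne', one_smul]
    rw [this]
    ext i j; simp; ring
  rw [e, pp_smul, h0, mul_zero]

lemma stab' (hm : m ≤ n) {A X : Matrix (Fin n) (Fin n) ℝ} (h : Cn m A) (hX : X.IsHermitian)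
    (v : ℝ) (hv : v ≠ 0) :
    pp m (cm X + (v * Complex.I) • cm A) ≠ 0 := by
  have := stab hm h (hX.smul (IsSelfAdjoint.all (v⁻¹)))
  intro h0
  apply this
  have hv' : (v : ℂ) ≠ 0 := by exact_mod_cast hv
  have e : cm (v⁻¹ • X) + Complex.I • cm A = (v⁻¹ : ℂ) • (cm X + (v * Complex.I) • cm A) := by
    ext i j; simp; field_simp
  rw [e, pp_smul, h0, mul_zero]

lemma Cn.one_add (hm : m ≤ n) {A : Matrix (Fin n) (Fin n) ℝ} (h : Cn m A) (s : ℝ) (hs : 0 ≤ s) :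
    Cn m (1 + s • A) := by
  rcases hs.eq_or_lt with rfl | hs
  · simpa using Cn_one hm
  · have := (h.smul s hs).add_one 1 zero_le_one
    rwa [one_smul, add_comm] at this

lemma conv_aux (hm : m ≤ n) {A B : Matrix (Fin n) (Fin n) ℝ} (hA : Cn m A) (hB : Cn m B)
    (s : ℝ) (hs : 0 ≤ s) (w : ℝ) (hw : 0 ≤ w) : pp m (B + w • (1 + s • A)) ≠ 0 := by
  have key := clopen_disc (fun σ z => pp m ((1 - z) • cm B + (1 + z) • cm (1 + (σ * s) • A)))
    ?_ ?_ ?_ ?_ (((w - 1) / (w + 1) : ℝ) : ℂ) ?_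
  · intro h0
    apply key
    have e : ((1:ℂ) - (((w - 1) / (w + 1) : ℝ) : ℂ)) • cm B + ((1:ℂ) + (((w - 1) / (w + 1) : ℝ) : ℂ)) • cm (1 + (1 * s) • A)
      = ((2 / (w + 1) : ℝ) : ℂ) • cm (B + w • (1 + s • A)) := by
      have hu1 : (w : ℂ) + 1 ≠ 0 := by exact_mod_cast (by linarith : w + 1 ≠ 0)
      ext i j; simp [Matrix.one_apply]; split_ifs <;> simp <;> field_simp <;> ring
    rw [e, pp_smul, pp_cm, h0]; simp
  · unfold pp MM Function.uncurry; simp [Matrix.add_apply, Matrix.smul_apply, -map_mul]; fun_prop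
  · intro s
    unfold pp MM; simp only [Matrix.add_apply, Matrix.smul_apply, smul_eq_mul]; fun_prop
  · intro σ hσ z hz
    have hC := hA.one_add hm (σ * s) (mul_nonneg hσ.1 hs)
    by_cases h1 : z = 1
    · subst h1
      have e : (1 - (1:ℂ)) • cm B + (1 + (1:ℂ)) • cm (1 + (σ * s) • A) = (2:ℂ) • cm (1 + (σ * s) • A) := by
        simp only [sub_self, zero_smul, zero_add]; norm_num
      simp only [e, pp_smul, pp_cm]
      exact mul_ne_zero (by simp) (by exact_mod_cast hC.pos.ne')
    · have h1' : 1 - z ≠ 0 := sub_ne_zero.2 (Ne.symm h1)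
      have hr := cayley_re' z hz
      obtain ⟨r, hr⟩ : ∃ r : ℝ, (1 + z) = (1 - z) * (r * Complex.I) := by
        refine ⟨((1 + z) / (1 - z)).im, ?_⟩
        have : (1 + z) / (1 - z) = (((1 + z) / (1 - z)).im : ℂ) * Complex.I := by
          apply Complex.ext <;> simp [hr]
        rw [div_eq_iff h1'] at this
        rw [mul_comm]; exact this
      have e : (1 - z) • cm B + (1 + z) • cm (1 + (σ * s) • A) = 
          (1 - z) • (cm B + (r * Complex.I) • cm (1 + (σ * s) • A)) := by
        rw [hr, smul_add, smul_smul]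
      simp only [e, pp_smul]
      refine mul_ne_zero (pow_ne_zero _ h1') ?_
      by_cases hr0 : r = 0
      · subst hr0
        simp only [Complex.ofReal_zero, zero_mul, zero_smul, add_zero, pp_cm]
        exact_mod_cast hB.pos.ne'
      · exact stab' hm hC hB.1 r hr0
  · intro z hz
    have e : (1 - z) • cm B + (1 + z) • cm (1 + ((0:ℝ) * s) • A) = 
        (1 - z) • cm B + (1 + z) • (1 : Matrix (Fin n) (Fin n) ℂ) := by
      simp
    simp only [e]
    exact pp_rhp_h hm hB z hz
  · rw [Complex.norm_real, Real.norm_eq_abs, abs_le, le_div_iff₀ (by linarith), div_le_iff₀ (by linarith)]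
    constructor <;> linarith

lemma conv_aux' (hm : m ≤ n) {A B : Matrix (Fin n) (Fin n) ℝ} (hA : Cn m A) (hB : Cn m B)
    (s : ℝ) (hs : 0 ≤ s) (w : ℝ) (hw : 0 ≤ w) : 0 < pp m (B + w • (1 + s • A)) := by
  by_contra hn
  have hc : Continuous fun w : ℝ => pp m (B + w • (1 + s • A)) := by
    unfold pp MM; simp only [Matrix.add_apply, Matrix.smul_apply]; fun_prop
  obtain ⟨x, hx, hx0⟩ := intermediate_value_Icc' hw hc.continuousOn
    (show (0:ℝ) ∈ _ from ⟨not_lt.1 hn, by simpa using hB.pos.le⟩)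
  exact conv_aux hm hA hB s hs x hx.1 hx0

lemma Cn.add (hm : m ≤ n) {A B : Matrix (Fin n) (Fin n) ℝ} (hA : Cn m A) (hB : Cn m B) :
    Cn m (B + A) := by
  refine ⟨hB.1.add hA.1, fun w hw => ?_⟩
  obtain ⟨ε, hε, h'⟩ := hB.sub_one
  have hw' : 0 < w + ε := by linarith
  have := conv_aux' hm hA h' (w + ε)⁻¹ (by positivity) (w + ε) hw'.le
  have e : B + A + w • (1 : Matrix (Fin n) (Fin n) ℝ) =
    B - ε • (1 : Matrix (Fin n) (Fin n) ℝ) + (w + ε) • (1 + (w + ε)⁻¹ • A) := by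
    rw [smul_add, smul_smul, mul_inv_cancel₀ hw'.ne', one_smul, add_smul]; abel
  rwa [e]

lemma Cn.add_smul (hm : m ≤ n) {A B : Matrix (Fin n) (Fin n) ℝ} (hA : Cn m A) (hB : Cn m B)
    (t : ℝ) (ht : 0 ≤ t) : Cn m (B + t • A) := by
  rcases ht.eq_or_lt with rfl | ht
  · simpa using hB
  · exact Cn.add hm (hA.smul t ht) hB

end


lemma MM_derivative {n m : ℕ} (B : Fin m → Matrix (Fin n) (Fin n) (Polynomial ℂ)) :
    Polynomial.derivative (MM B) =
      ∑ b, MM (Function.update B b ((B b).map Polynomial.derivative)) := by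
  unfold MM
  rw [Polynomial.derivative_sum, Finset.sum_comm]
  refine Finset.sum_congr rfl fun i _ => ?_
  rw [Polynomial.derivative_sum, Finset.sum_comm]
  refine Finset.sum_congr rfl fun σ _ => ?_
  rw [Polynomial.derivative_intCast_mul, Polynomial.derivative_prod_finset, Finset.mul_sum]
  refine Finset.sum_congr rfl fun b _ => ?_
  congr 1
  rw [← Finset.mul_prod_erase _ _ (Finset.mem_univ b), mul_comm]
  congr 1
  · simp
  · refine Finset.prod_congr rfl fun a ha => ?_
    rw [Function.update_of_ne (Finset.ne_of_mem_erase ha)]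

lemma MM_zero_slot {R : Type*} [CommRing R] {n m : ℕ} (B : Fin m → Matrix (Fin n) (Fin n) R)
    (b : Fin m) (h : B b = 0) : MM B = 0 := by
  unfold MM
  refine Finset.sum_eq_zero fun i _ => Finset.sum_eq_zero fun σ _ => ?_
  rw [Finset.prod_eq_zero (Finset.mem_univ b) (by simp [h]), mul_zero]

/-- partially specialised family -/
def ff {n m : ℕ} (A : Fin m → Matrix (Fin n) (Fin n) ℂ) (r : ℕ) (Z : Matrix (Fin n) (Fin n) ℂ) :
    Fin m → Matrix (Fin n) (Fin n) ℂ := fun a => if a.val < r then A a else Z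

lemma ff_smul {n m : ℕ} (A : Fin m → Matrix (Fin n) (Fin n) ℂ) (r : ℕ) :
    ∃ e : ℕ, (r < m → e ≠ 0) ∧ ∀ (Z : Matrix (Fin n) (Fin n) ℂ) (c : ℂ), MM (ff A r (c • Z)) = c ^ e * MM (ff A r Z) := by
  refine ⟨(Finset.univ.filter fun a : Fin m => ¬ a.val < r).card, ?_, ?_⟩
  · intro h
    rw [Finset.card_ne_zero]
    exact ⟨⟨r, h⟩, by simp⟩
  · intro Z c
    unfold MM
    rw [Finset.mul_sum]
    refine Finset.sum_congr rfl fun i _ => ?_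
    rw [Finset.mul_sum]
    refine Finset.sum_congr rfl fun σ _ => ?_
    have : ∏ a, ff A r (c • Z) a (i a) (i (σ a)) =
        ∏ a, ((if ¬ a.val < r then c else 1) * ff A r Z a (i a) (i (σ a))) := by
      refine Finset.prod_congr rfl fun a _ => ?_
      unfold ff
      split_ifs <;> simp
    rw [this, Finset.prod_mul_distrib, ← Finset.prod_filter, Finset.prod_const]
    ring

lemma ff_ne {n m : ℕ} (hm : m ≤ n) (A : Fin m → Matrix (Fin n) (Fin n) ℝ) (hA : ∀ a, Cn m (A a))
    (r : ℕ) (hr : r ≤ m) : ∀ X A0 : Matrix (Fin n) (Fin n) ℝ, X.IsHermitian → Cn m A0 →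
      MM (ff (fun a => cm (A a)) r (cm X + Complex.I • cm A0)) ≠ 0 := by
  induction r with
  | zero =>
    intro X A0 hX h0
    exact stab hm h0 hX
  | succ r ih =>
    intro X A0 hX h0
    have ih := ih (by omega)
    set b : Fin m := ⟨r, by omega⟩ with hb
    set A' : Fin m → Matrix (Fin n) (Fin n) ℂ := fun a => cm (A a) with hA'
    set Z := cm X + Complex.I • cm A0 with hZ
    set B : Fin m → Matrix (Fin n) (Fin n) (Polynomial ℂ) := fun a =>
      if a.val < r then (A' a).map Polynomial.C else
        Z.map Polynomial.C + (Polynomial.X : Polynomial ℂ) • (A' b).map Polynomial.C with hB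
    have heval : ∀ t : ℂ, (MM B).eval t = MM (ff A' r (Z + t • A' b)) := by
      intro t
      have := MM_map (Polynomial.evalRingHom t) B
      rw [Polynomial.coe_evalRingHom] at this
      rw [← this]
      congr 1
      funext a
      simp only [hB, ff]
      split_ifs
      · ext; simp
      · ext; simp; ring
    have hroot : ∀ t : ℂ, 0 ≤ t.im → (MM B).eval t ≠ 0 := by
      intro t ht
      rw [heval]
      have e : Z + t • A' b = cm (X + t.re • A b) + Complex.I • cm (A0 + t.im • A b) := by
        conv_lhs => rw [← Complex.re_add_im t]
        ext i j
        simp only [hZ, hA', Matrix.add_apply, Matrix.smul_apply, Matrix.map_apply, smul_eq_mul,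
          map_add, map_mul, Complex.ofRealHom_eq_coe]
        ring
      rw [e]
      exact ih _ _ (hX.add ((hA b).1.smul (IsSelfAdjoint.all _))) (Cn.add_smul hm (hA b) h0 _ ht)
    have hdeg : 0 < (MM B).natDegree := by
      by_contra hd
      have hconst : ∀ t, (MM B).eval t = (MM B).coeff 0 := by
        intro t
        rw [Polynomial.eq_C_of_natDegree_eq_zero (by omega : (MM B).natDegree = 0)]
        simp
      obtain ⟨e, he0, he⟩ : ∃ e : ℕ, e ≠ 0 ∧ ∀ s : ℂ, s ≠ 0 →
          MM (ff A' r (s • Z + A' b)) = s ^ e * (MM B).coeff 0 := by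
        obtain ⟨e, he0, hsm⟩ := ff_smul A' r
        refine ⟨e, he0 (by omega), fun s hs => ?_⟩
        rw [← hconst s⁻¹, heval, ← hsm, smul_add s Z, smul_smul s s⁻¹, mul_inv_cancel₀ hs, one_smul]
      have hc : Continuous fun s : ℂ => MM (ff A' r (s • Z + A' b)) := by
        unfold MM ff
        refine continuous_finsetSum _ fun i _ => continuous_finsetSum _ fun σ _ => ?_
        refine continuous_const.mul (continuous_finsetProd _ fun a _ => ?_)
        split_ifs
        · fun_prop
        · simp only [Matrix.add_apply, Matrix.smul_apply]; fun_prop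
      have hext := Continuous.ext_on (dense_compl_singleton (0:ℂ)) hc
        (show Continuous fun s : ℂ => s ^ e * (MM B).coeff 0 by fun_prop) (fun s hs => he s hs)
      have h00 := congrFun hext 0
      simp only [zero_smul, zero_add, zero_pow he0, zero_mul] at h00
      have h1 := ih 0 (A b) (by simp [Matrix.IsHermitian]) (hA b)
      obtain ⟨e', _, he'⟩ := ff_smul A' r
      apply h1
      have : cm (0 : Matrix (Fin n) (Fin n) ℝ) + Complex.I • cm (A b) = Complex.I • A' b := by
        ext; simp [hA']
      rw [this, he', h00, mul_zero]
    have hder := gauss_lucas_im _ hdeg hroot 0 (by simp)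
    intro h0
    apply hder
    rw [MM_derivative, Polynomial.eval_finsetSum]
    refine Finset.sum_eq_zero fun a _ => ?_
    by_cases har : a.val < r
    · rw [MM_zero_slot _ a, Polynomial.eval_zero]
      ext i j
      simp [hB, har]
    · have := MM_map (Polynomial.evalRingHom (0:ℂ)) (Function.update B a ((B a).map Polynomial.derivative))
      rw [Polynomial.coe_evalRingHom] at this
      rw [← this, ← MM_perm _ (Equiv.swap a b)]
      refine Eq.trans ?_ h0
      congr 1
      funext c
      simp only [ff]
      by_cases hcb : c = b
      · subst hcb
        rw [Equiv.swap_apply_right, Function.update_self, if_pos (by simp [hb])]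
        ext i j
        simp [hB, har]
      · have hcb' : c.val ≠ r := fun h => hcb (Fin.ext h)
        by_cases hca : c = a
        · subst hca
          rw [Equiv.swap_apply_left, Function.update_of_ne (Ne.symm hcb), if_neg (by omega)]
          ext i j
          simp [hB, hb]
        · rw [Equiv.swap_apply_of_ne_of_ne hca hcb, Function.update_of_ne hca]
          by_cases hcr : c.val < r
          · rw [if_pos (by omega)]
            ext i j
            simp [hB, hcr]
          · rw [if_neg (by omega)]
            ext i j
            simp [hB, hcr]

lemma MM_ne {n m : ℕ} (hm : m ≤ n) (A : Fin m → Matrix (Fin n) (Fin n) ℝ) (hA : ∀ a, Cn m (A a)) :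
    MM A ≠ 0 := by
  have := ff_ne hm A hA m le_rfl 0 1 (by simp [Matrix.IsHermitian]) (Cn_one hm)
  intro h0
  apply this
  have h1 := MM_map Complex.ofRealHom A
  rw [h0, map_zero] at h1
  rw [← h1]
  congr 1
  funext a
  simp [ff]

lemma MM_pos {n m : ℕ} (hm : m ≤ n) (A : Fin m → Matrix (Fin n) (Fin n) ℝ) (hA : ∀ a, Cn m (A a)) :
    0 < MM A := by
  by_contra hn
  have hc : Continuous fun s : ℝ => MM (fun a => (1 - s) • A a + s • (1 : Matrix (Fin n) (Fin n) ℝ)) := by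
    unfold MM; simp only [Matrix.add_apply, Matrix.smul_apply]; fun_prop
  have h1 : 0 < MM (fun _ : Fin m => (1 : Matrix (Fin n) (Fin n) ℝ)) := (Cn_one hm).pos
  obtain ⟨s, hs, hs0⟩ := intermediate_value_Icc (zero_le_one (α := ℝ)) hc.continuousOn
    (show (0:ℝ) ∈ _ from ⟨by simpa using hn, by simpa using h1.le⟩)
  refine MM_ne hm _ (fun a => ?_) hs0
  rcases hs.2.eq_or_lt with rfl | hlt
  · simpa using Cn_one hm
  · exact ((hA a).smul (1 - s) (by linarith)).add_one s hs.1

lemma MM_psd {n k : ℕ} (hm : k + 1 ≤ n) (A : Fin k → Matrix (Fin n) (Fin n) ℝ)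
    (hA : ∀ a, Cn (k + 1) (A a)) (P : Matrix (Fin n) (Fin n) ℝ) (hP : P.PosSemidef) :
    0 ≤ MM (Fin.cons P A : Fin (k + 1) → _) := by
  have hu : ∀ Q, (Fin.cons Q A : Fin (k + 1) → Matrix (Fin n) (Fin n) ℝ) =
      Function.update (Fin.cons P A : Fin (k + 1) → _) 0 Q := by
    intro Q; simp
  have h1 : ∀ t : ℝ, 0 < t → 0 < MM (Fin.cons P A : Fin (k + 1) → _) +
      t * MM (Fin.cons 1 A : Fin (k + 1) → _) := by
    intro t ht
    have := MM_update_add (Fin.cons P A : Fin (k + 1) → _) 0 P 1 t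
    rw [← hu, ← hu, ← hu] at this
    rw [← this]
    refine MM_pos hm _ fun a => ?_
    refine Fin.cases ?_ (fun a => ?_) a
    · simpa using pp_psd hm hP t ht
    · simpa using hA a
  have h2 : 0 < MM (Fin.cons 1 A : Fin (k + 1) → _) := by
    refine MM_pos hm _ fun a => ?_
    refine Fin.cases ?_ (fun a => ?_) a
    · simpa using Cn_one hm
    · simpa using hA a
  by_contra hn
  push Not at hn
  have := h1 (-MM (Fin.cons P A : Fin (k + 1) → _) / MM (Fin.cons 1 A : Fin (k + 1) → _)) (div_pos (by linarith) h2)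
  rw [div_mul_cancel₀ _ h2.ne'] at this
  linarith

lemma MM_psd_pos {n k : ℕ} (hm : k + 1 ≤ n) (A : Fin k → Matrix (Fin n) (Fin n) ℝ)
    (hA : ∀ a, Cn (k + 1) (A a)) (P : Matrix (Fin n) (Fin n) ℝ) (hP : P.PosSemidef)
    (h1 : 0 < MM (Fin.cons P (fun _ => 1) : Fin (k + 1) → _)) :
    0 < MM (Fin.cons P A : Fin (k + 1) → _) := by
  classical
  refine lt_of_le_of_ne (MM_psd hm A hA P hP) fun h0 => ?_
  have key : ∀ S : Finset (Fin k), MM (Fin.cons P (fun a => if a ∈ S then 1 else A a) : Fin (k + 1) → _) = 0 := by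
    intro S
    induction S using Finset.induction_on with
    | empty => simpa using h0.symm
    | insert b S hb ih =>
      set A1 : Fin k → Matrix (Fin n) (Fin n) ℝ := fun a => if a ∈ S then 1 else A a with hA1
      have hA1c : ∀ a, Cn (k + 1) (A1 a) := by
        intro a; simp only [hA1]; split_ifs
        · exact Cn_one hm
        · exact hA a
      have e1 : (fun a => if a ∈ insert b S then (1 : Matrix (Fin n) (Fin n) ℝ) else A a) = Function.update A1 b 1 := by
        funext a
        by_cases h : a = b
        · subst h; simp
        · simp [h, hA1]
      rw [e1]
      obtain ⟨ε, hε, hC⟩ := (hA1c b).sub_one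
      have hupd : ∀ Q, Cn (k + 1) Q → 0 ≤ MM (Function.update (Fin.cons P A1 : Fin (k + 1) → _) b.succ Q) := by
        intro Q hQ
        rw [← Fin.cons_update]
        refine MM_psd hm _ (fun a => ?_) P hP
        by_cases h : a = b
        · subst h; simpa using hQ
        · simpa [h] using hA1c a
      have h2 := hupd _ hC
      have h3 := hupd 1 (Cn_one hm)
      rw [sub_eq_add_neg, ← neg_smul, MM_update_add] at h2
      have e2 : Function.update (Fin.cons P A1 : Fin (k + 1) → Matrix (Fin n) (Fin n) ℝ) b.succ (A1 b) = Fin.cons P A1 := by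
        rw [← Fin.cons_update, Function.update_eq_self]
      rw [e2, ih] at h2
      rw [← Fin.cons_update] at h2 h3
      nlinarith
  have := key Finset.univ
  simp at this
  linarith


lemma MM_diag' {n m : ℕ} (D : Fin m → Fin n → ℝ) :
    MM (fun a => Matrix.diagonal (D a)) =
      ∑ i : Fin m → Fin n, open Classical in if Function.Injective i then ∏ a, D a (i a) else 0 := by
  classical
  unfold MM
  refine Finset.sum_congr rfl fun i _ => ?_
  have : ∑ σ : Perm (Fin m), ((Perm.sign σ : ℤ) : ℝ) *
      ∏ a, (Matrix.diagonal (D a)) (i a) (i (σ a)) =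
      (Matrix.transpose (Matrix.of fun a b => Matrix.diagonal (D a) (i a) (i b))).det := by
    rw [Matrix.det_apply']; simp
  rw [this, Matrix.det_transpose]
  split_ifs with h
  · have e : (Matrix.of fun a b => Matrix.diagonal (D a) (i a) (i b)) =
        Matrix.diagonal fun a => D a (i a) := by
      ext a b
      simp only [Matrix.of_apply, Matrix.diagonal_apply, h.eq_iff]
    rw [e, Matrix.det_diagonal]
  · simp only [Function.Injective, not_forall] at h
    obtain ⟨a, b, hab, hne⟩ := h
    exact Matrix.det_zero_of_column_eq hne (by intro c; simp [hab])

lemma MM_rank_one {n k : ℕ} (hm : k + 1 ≤ n) (P : Matrix (Fin n) (Fin n) ℝ) (hP : P.PosSemidef)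
    (hP0 : P ≠ 0) : 0 < MM (Fin.cons P (fun _ => 1) : Fin (k + 1) → _) := by
  classical
  have h := hP.1.spectral_theorem
  rw [Unitary.conjStarAlgAut_apply] at h
  set U : Matrix (Fin n) (Fin n) ℝ := hP.1.eigenvectorUnitary.val
  have hU : star U * U = 1 := Unitary.coe_star_mul_self hP.1.eigenvectorUnitary
  have hU' : U * star U = 1 := Unitary.coe_mul_star_self hP.1.eigenvectorUnitary
  set D : Fin (k + 1) → Fin n → ℝ := Fin.cons hP.1.eigenvalues (fun _ _ => 1) with hD
  have e : (Fin.cons P (fun _ => 1) : Fin (k + 1) → Matrix (Fin n) (Fin n) ℝ) =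
      fun a => U * Matrix.diagonal (D a) * star U := by
    funext a
    refine Fin.cases ?_ (fun a => ?_) a
    · simp only [hD, Fin.cons_zero]
      exact h
    · simp [hD, hU']
  rw [e, MM_conj _ _ _ hU, MM_diag']
  have hnn : ∀ a x, 0 ≤ D a x := by
    intro a x
    refine Fin.cases ?_ (fun a => ?_) a
    · simpa [hD] using hP.eigenvalues_nonneg x
    · simp [hD]
  obtain ⟨j, hj⟩ : ∃ j, hP.1.eigenvalues j ≠ 0 := by
    by_contra hc
    push Not at hc
    exact hP0 (hP.1.eigenvalues_eq_zero_iff.1 (funext hc))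
  refine Finset.sum_pos' (fun i _ => ?_)
    ⟨fun a => Equiv.swap (Fin.castLE hm 0) j (Fin.castLE hm a), Finset.mem_univ _, ?_⟩
  · split_ifs
    · exact Finset.prod_nonneg fun a _ => hnn _ _
    · exact le_rfl
  · have hinj : Function.Injective (fun a : Fin (k + 1) =>
        Equiv.swap (Fin.castLE hm 0) j (Fin.castLE hm a)) :=
      (Equiv.injective _).comp (Fin.castLE_injective hm)
    rw [if_pos hinj, Fin.prod_univ_succ]
    simp only [hD, Fin.cons_zero, Fin.cons_succ, Finset.prod_const_one, mul_one,
      Equiv.swap_apply_left]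
    exact lt_of_le_of_ne (hP.eigenvalues_nonneg j) hj.symm

lemma gkdelta_comm {k n : ℕ} (i j : Fin k → Fin n) : gkdelta i j = gkdelta j i := by
  unfold gkdelta
  rw [← Matrix.det_transpose]
  congr 1
  ext a b
  simp [eq_comm]

lemma MM_eq_gk {n m : ℕ} (B : Fin m → Matrix (Fin n) (Fin n) ℝ) :
    MM B = ∑ i : Fin m → Fin n, ∑ j : Fin m → Fin n, gkdelta i j * ∏ a, B a (i a) (j a) := by
  unfold MM gkdelta
  refine Finset.sum_congr rfl fun i _ => ?_
  simp only [Matrix.det_apply', Finset.sum_mul]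
  rw [Finset.sum_comm]
  refine Finset.sum_congr rfl fun σ _ => ?_
  have : ∀ j : Fin m → Fin n, (∏ a, (Matrix.of fun a b => if i a = j b then (1:ℝ) else 0) (σ a) a) =
      if j = fun a => i (σ a) then 1 else 0 := by
    intro j
    simp only [Matrix.of_apply]
    rw [Finset.prod_ite_zero]
    simp only [Finset.prod_const_one]
    congr 1
    simp only [Finset.mem_univ, true_imp_iff, funext_iff, eq_iff_iff]
    exact ⟨fun h a => (h a).symm, fun h a => (h a).symm⟩
  simp only [this]
  simp

lemma polNewton_quad {n k : ℕ} (A : Fin k → Matrix (Fin n) (Fin n) ℝ) (v : Fin n → ℝ) :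
    star v ⬝ᵥ ((polNewton n k A).mulVec v) = (1 / (Nat.factorial k : ℝ)) *
      MM (Fin.cons (Matrix.vecMulVec v (star v)) A : Fin (k + 1) → _) := by
  rw [MM_eq_gk]
  have hs : ∀ F : (Fin (k + 1) → Fin n) → ℝ, ∑ i, F i = ∑ p : Fin n, ∑ i : Fin k → Fin n, F (Fin.cons p i) := by
    intro F
    rw [← Fintype.sum_prod_type']
    exact (Fintype.sum_equiv (Fin.consEquiv fun _ => Fin n) _ _ fun x => rfl).symm
  rw [hs, Finset.mul_sum]
  unfold polNewton dotProduct Matrix.mulVec dotProduct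
  refine Finset.sum_congr rfl fun p _ => ?_
  simp only [hs]
  rw [Finset.sum_comm]
  rw [Finset.mul_sum, Finset.mul_sum]
  refine Finset.sum_congr rfl fun q _ => ?_
  simp only [Matrix.of_apply, Fin.prod_univ_succ, Fin.cons_zero, Fin.cons_succ, Matrix.vecMulVec_apply,
    Finset.mul_sum, Finset.sum_mul, Pi.star_apply, star_trivial]
  refine Finset.sum_congr rfl fun i _ => Finset.sum_congr rfl fun j _ => ?_
  ring

lemma polNewton_herm {n k : ℕ} (A : Fin k → Matrix (Fin n) (Fin n) ℝ) (hA : ∀ a, (A a).IsHermitian) :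
    (polNewton n k A).IsHermitian := by
  ext p q
  simp only [polNewton, Matrix.conjTranspose_apply, Matrix.of_apply, star_trivial]
  congr 1
  rw [Finset.sum_comm]
  refine Finset.sum_congr rfl fun i _ => Finset.sum_congr rfl fun j _ => ?_
  rw [gkdelta_comm]
  congr 1
  refine Finset.prod_congr rfl fun a _ => ?_
  simpa using (hA a).apply (i a) (j a)

/-- Garding: if `A₁,...,A_k` are symmetric with eigenvalues in `Γ_{k+1}⁺`, then the
polarized Newton tensor `[Tₖ](A₁,...,A_k)` is positive definite. -/
theorem polNewton_posDef (n k : ℕ) (hkn : k + 1 ≤ n)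
    (A : Fin k → Matrix (Fin n) (Fin n) ℝ) (hA : ∀ a, (A a).IsHermitian)
    (hcone : ∀ a, inGamma n (k + 1) (hA a).eigenvalues) :
    (polNewton n k A).PosDef := by
  refine Matrix.PosDef.of_dotProduct_mulVec_pos (polNewton_herm A hA) fun v hv => ?_
  rw [polNewton_quad]
  refine mul_pos (by positivity) ?_
  have hC : ∀ a, Cn (k + 1) (A a) := by
    intro a
    refine ⟨hA a, fun w hw => ?_⟩
    have h := pp_spectral (m := k + 1) (RingHom.id ℝ) (hA a) w
    simp only [RingHom.id_apply] at h
    rw [show (A a).map (RingHom.id ℝ) = A a by ext; simp] at h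
    rw [h]
    exact mul_pos (by exact_mod_cast (k + 1).factorial_pos) (esum_pos_s13 hkn _ (hcone a) w hw)
  have hP : (Matrix.vecMulVec v (star v)).PosSemidef := Matrix.posSemidef_vecMulVec_self_star v
  refine MM_psd_pos hkn A hC _ hP (MM_rank_one hkn _ hP fun h0 => hv ?_)
  funext i
  have := congrFun (congrFun h0 i) i
  simpa [Matrix.vecMulVec_apply] using this
end

section
/- For λ ∈ Γₖ⁺, the function λ ↦ σₖ(λ)^{1/k} is concave on the cone Γₖ⁺. -/
namespace GardingAux

open Polynomial Finset

/-- Elementary symmetric polynomial over a finset of variables. -/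
noncomputable def es {ι : Type*} (S : Finset ι) (k : ℕ) (x : ι → ℝ) : ℝ :=
  ∑ s ∈ Finset.powersetCard k S, ∏ i ∈ s, x i

/-- The Garding cone over a finset of variables. -/
def Gam {ι : Type*} (S : Finset ι) (k : ℕ) (x : ι → ℝ) : Prop :=
  ∀ j ≤ k, 0 < es S j x

lemma es_zero {ι : Type*} (S : Finset ι) (x : ι → ℝ) : es S 0 x = 1 := by
  simp [es]

lemma splits_derivative (p : ℝ[X]) (hp : p.Splits) : (derivative p).Splits := by
  by_cases h0 : p.natDegree = 0
  · rw [natDegree_eq_zero] at h0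
    obtain ⟨c, rfl⟩ := h0
    simp
  rw [splits_iff_card_roots] at hp ⊢
  have h1 := card_roots_le_derivative p
  have h2 := card_roots' (derivative p)
  have h3 := natDegree_derivative_lt h0
  omega

lemma splits_iterate (p : ℝ[X]) (hp : p.Splits) (m : ℕ) : (derivative^[m] p).Splits := by
  induction m with
  | zero => simpa
  | succ m ih =>
    rw [Function.iterate_succ_apply']
    exact splits_derivative _ ih

lemma laguerre (p : ℝ[X]) (hp : p.Splits) (x : ℝ) :
    p.eval x * (derivative (derivative p)).eval x ≤ (derivative p).eval x ^ 2 := by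
  obtain ⟨m, hm⟩ := splits_iff_exists_multiset.1 hp
  have key : ∀ (m : Multiset ℝ) (c : ℝ) (p : ℝ[X]), p = C c * (m.map (X - C ·)).prod →
      p.eval x * (derivative (derivative p)).eval x ≤ (derivative p).eval x ^ 2 := by
    intro m
    induction m using Multiset.induction_on with
    | empty => rintro c p rfl; simp
    | cons a m ih =>
      rintro c p rfl
      have h := ih c _ rfl
      set q := C c * (m.map (X - C ·)).prod with hq
      have e : C c * ((a ::ₘ m).map (X - C ·)).prod = (X - C a) * q := by
        rw [Multiset.map_cons, Multiset.prod_cons, hq]; ring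
      rw [e]
      simp only [derivative_mul, derivative_add, derivative_sub, derivative_X, derivative_C,
        sub_zero, one_mul, eval_add, eval_mul, eval_sub, eval_X, eval_C]
      nlinarith [mul_le_mul_of_nonneg_left h (sq_nonneg (x - a)), sq_nonneg (eval x q)]
  exact key m _ p hm

lemma newton {ι : Type*} (S : Finset ι) (k : ℕ) (x : ι → ℝ) :
    es S k x * es S (k + 2) x ≤ es S (k + 1) x ^ 2 := by
  by_cases hc : S.card < k + 2
  · have : es S (k + 2) x = 0 := by
      unfold es
      rw [Finset.powersetCard_eq_empty.2 hc, Finset.sum_empty]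
    rw [this, mul_zero]; positivity
  push Not at hc
  obtain ⟨m, hm⟩ := Nat.exists_eq_add_of_le hc
  set p : ℝ[X] := ∏ i ∈ S, (X + C (x i)) with hp
  have hps : p.Splits := Splits.prod fun i _ => Splits.X_add_C _
  have hcoef : ∀ j ≤ S.card, p.coeff j = es S (S.card - j) x := fun j hj =>
    Finset.prod_X_add_C_coeff S x hj
  have h0 : p.coeff m = es S (k + 2) x := by
    rw [hcoef m (by omega)]; congr 1; omega
  have h1 : p.coeff (m + 1) = es S (k + 1) x := by
    rw [hcoef (m + 1) (by omega)]; congr 1; omega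
  have h2 : p.coeff (m + 2) = es S k x := by
    rw [hcoef (m + 2) (by omega)]; congr 1; omega
  have hL := laguerre _ (splits_iterate p hps m) 0
  rw [← coeff_zero_eq_eval_zero, ← coeff_zero_eq_eval_zero, ← coeff_zero_eq_eval_zero,
    ← Function.iterate_succ_apply' derivative, ← Function.iterate_succ_apply' derivative,
    coeff_iterate_derivative, coeff_iterate_derivative, coeff_iterate_derivative] at hL
  simp only [zero_add, Nat.descFactorial_self, nsmul_eq_mul, Nat.succ_eq_add_one] at hL
  rw [h0, h1, add_assoc, one_add_one_eq_two, h2] at hL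
  by_cases hneg : es S k x * es S (k + 2) x ≤ 0
  · exact hneg.trans (sq_nonneg _)
  push Not at hneg
  have hf : (0 : ℝ) < (m.factorial : ℝ) := by positivity
  have e1 : ((m + 1).factorial : ℝ) = (m + 1) * m.factorial := by
    rw [Nat.factorial_succ]; push_cast; ring
  have e2 : ((m + 2).factorial : ℝ) = (m + 2) * ((m + 1) * m.factorial) := by
    rw [Nat.factorial_succ, Nat.factorial_succ]; push_cast; ring
  rw [e1, e2] at hL
  have hm0 : (0 : ℝ) ≤ m := by positivity
  have hF : 0 < (m.factorial : ℝ) ^ 2 * ((m : ℝ) + 1) := by positivity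
  have h3 : (m.factorial : ℝ) ^ 2 * ((m : ℝ) + 1) * ((m + 2) * (es S k x * es S (k + 2) x)) ≤
      (m.factorial : ℝ) ^ 2 * ((m : ℝ) + 1) * ((m + 1) * es S (k + 1) x ^ 2) := by
    nlinarith [hL]
  have h4 := le_of_mul_le_mul_left h3 hF
  have h5 : ((m : ℝ) + 1) * (es S k x * es S (k + 2) x) ≤ (m + 1) * es S (k + 1) x ^ 2 := by
    linarith
  exact le_of_mul_le_mul_left h5 (by positivity)

lemma es_erase {ι : Type*} [DecidableEq ι] (S : Finset ι) (k : ℕ) (x : ι → ℝ) (i : ι)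
    (hi : i ∈ S) : es S (k + 1) x = x i * es (S.erase i) k x + es (S.erase i) (k + 1) x := by
  unfold es
  conv_lhs => rw [← Finset.insert_erase hi]
  have hn : i ∉ S.erase i := Finset.notMem_erase i S
  rw [Finset.powersetCard_succ_insert hn, Finset.sum_union, add_comm, Finset.sum_image,
    Finset.mul_sum]
  · congr 1
    refine Finset.sum_congr rfl fun t ht => ?_
    rw [Finset.prod_insert]
    exact fun h => hn ((Finset.mem_powersetCard.1 ht).1 h)
  · intro s hs t ht hst
    have hs' : i ∉ s := fun h => hn ((Finset.mem_powersetCard.1 hs).1 h)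
    have ht' : i ∉ t := fun h => hn ((Finset.mem_powersetCard.1 ht).1 h)
    rw [← Finset.erase_insert hs', ← Finset.erase_insert ht']
    exact congrArg (fun u => Finset.erase u i) hst
  · rw [Finset.disjoint_left]
    intro s hs hs'
    obtain ⟨t, _, rfl⟩ := Finset.mem_image.1 hs'
    exact hn ((Finset.mem_powersetCard.1 hs).1 (Finset.mem_insert_self i t))

lemma es_euler {ι : Type*} [DecidableEq ι] (S : Finset ι) (k : ℕ) (x : ι → ℝ) :
    ∑ i ∈ S, x i * es (S.erase i) k x = (k + 1) * es S (k + 1) x := by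
  have h : ∀ i ∈ S, x i * es (S.erase i) k x =
      ∑ s ∈ Finset.powersetCard (k + 1) S, if i ∈ s then ∏ j ∈ s, x j else 0 := by
    intro i hi
    have h1 := es_erase S k x i hi
    have h2 : es (S.erase i) (k + 1) x =
        ∑ s ∈ Finset.powersetCard (k + 1) S, if i ∈ s then 0 else ∏ j ∈ s, x j := by
      unfold es
      simp_rw [← ite_not (p := i ∈ _)]
      rw [← Finset.sum_filter]
      refine Finset.sum_congr ?_ fun _ _ => rfl
      ext s
      simp only [Finset.mem_powersetCard, Finset.mem_filter, Finset.subset_erase]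
      tauto
    have h3 : x i * es (S.erase i) k x = es S (k + 1) x - es (S.erase i) (k + 1) x := by
      linarith
    rw [h3, h2]
    unfold es
    rw [← Finset.sum_sub_distrib]
    refine Finset.sum_congr rfl fun s _ => ?_
    split_ifs <;> simp
  rw [Finset.sum_congr rfl h, Finset.sum_comm]
  unfold es
  rw [Finset.mul_sum]
  refine Finset.sum_congr rfl fun s hs => ?_
  obtain ⟨h1, h2⟩ := Finset.mem_powersetCard.1 hs
  rw [← Finset.sum_filter, Finset.filter_mem_eq_inter, Finset.inter_eq_right.2 h1,
    Finset.sum_const, h2, nsmul_eq_mul]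
  push_cast; ring

lemma Gam.mono {ι : Type*} {S : Finset ι} {k l : ℕ} {x : ι → ℝ} (h : Gam S k x) (hl : l ≤ k) :
    Gam S l x := fun j hj => h j (hj.trans hl)

lemma Gam.erase {ι : Type*} [DecidableEq ι] {S : Finset ι} {k : ℕ} {x : ι → ℝ} {i : ι}
    (hi : i ∈ S) (h : Gam S (k + 1) x) : Gam (S.erase i) k x := by
  induction k with
  | zero =>
    intro j hj
    obtain rfl : j = 0 := by omega
    rw [es_zero]; exact one_pos
  | succ k ih =>
    have ih' := ih (h.mono (by omega))
    intro j hj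
    rcases Nat.lt_or_ge j (k + 1) with hlt | hge
    · exact ih' j (by omega)
    obtain rfl : j = k + 1 := by omega
    have ha := ih' k le_rfl
    have h1 := h (k + 1) (by omega)
    have h2 := h (k + 2) (by omega)
    rw [es_erase S k x i hi] at h1
    rw [es_erase S (k + 1) x i hi] at h2
    have hN := newton (S.erase i) k x
    by_contra hb
    push Not at hb
    nlinarith [mul_pos ha h2, mul_nonneg (neg_nonneg.2 hb) h1.le]

lemma sq_div_aux {a b p q c : ℝ} (hp : 0 < p) (hq : 0 < q) (hc : p + q ≤ c) :
    (a + b) ^ 2 / c ≤ a ^ 2 / p + b ^ 2 / q := by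
  have hpq : 0 < p + q := by positivity
  calc (a + b) ^ 2 / c ≤ (a + b) ^ 2 / (p + q) := by gcongr
    _ ≤ a ^ 2 / p + b ^ 2 / q := by
      rw [div_add_div _ _ hp.ne' hq.ne', div_le_div_iff₀ hpq (by positivity)]
      have : (a ^ 2 * q + p * b ^ 2) * (p + q) - (a + b) ^ 2 * (p * q) = (a * q - b * p) ^ 2 := by
        ring
      nlinarith [sq_nonneg (a * q - b * p)]

lemma quot_formula {ι : Type*} [DecidableEq ι] (S : Finset ι) (k : ℕ) (x : ι → ℝ)
    (h0 : es S (k + 1) x ≠ 0) :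
    ((k : ℝ) + 2) * (es S (k + 2) x / es S (k + 1) x) =
      ∑ i ∈ S, x i - ∑ i ∈ S, x i ^ 2 / (es S (k + 1) x / es (S.erase i) k x) := by
  have h := es_euler S (k + 1) x
  have h2 : ∀ i ∈ S, x i - x i ^ 2 / (es S (k + 1) x / es (S.erase i) k x) =
      (x i * es (S.erase i) (k + 1) x) / es S (k + 1) x := by
    intro i hi
    have := es_erase S k x i hi
    rw [div_div_eq_mul_div, eq_div_iff h0, sub_mul, div_mul_cancel₀ _ h0, this]
    ring
  rw [← Finset.sum_sub_distrib, Finset.sum_congr rfl h2, ← Finset.sum_div, h]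
  push_cast; ring

lemma main_step {ι : Type*} [DecidableEq ι] (k : ℕ) : ∀ (S : Finset ι) (x y : ι → ℝ),
    Gam S (k + 1) x → Gam S (k + 1) y → Gam S (k + 1) (x + y) ∧
      es S (k + 1) x / es S k x + es S (k + 1) y / es S k y ≤
        es S (k + 1) (x + y) / es S k (x + y) := by
  induction k with
  | zero =>
    intro S x y hx hy
    have e1 : ∀ z : ι → ℝ, es S 1 z = ∑ i ∈ S, z i := fun z => by
      simp [es, Finset.powersetCard_one]
    have e2 : es S 1 (x + y) = es S 1 x + es S 1 y := by
      simp [e1, Finset.sum_add_distrib]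
    refine ⟨?_, by simp [es_zero, e2]⟩
    intro j hj
    rcases Nat.eq_zero_or_pos j with rfl | hj0
    · rw [es_zero]; exact one_pos
    · obtain rfl : j = 1 := by omega
      rw [e2]; exact add_pos (hx 1 (by omega)) (hy 1 (by omega))
  | succ k ih =>
    intro S x y hx hy
    have hG := (ih S x y (hx.mono (by omega)) (hy.mono (by omega))).1
    have px := hx (k + 1) (by omega)
    have py := hy (k + 1) (by omega)
    have pz := hG (k + 1) le_rfl
    have fx := quot_formula S k x px.ne'
    have fy := quot_formula S k y py.ne'
    have fz := quot_formula S k (x + y) pz.ne'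
    have hle : ∑ i ∈ S, (x + y) i ^ 2 / (es S (k + 1) (x + y) / es (S.erase i) k (x + y)) ≤
        ∑ i ∈ S, x i ^ 2 / (es S (k + 1) x / es (S.erase i) k x) +
        ∑ i ∈ S, y i ^ 2 / (es S (k + 1) y / es (S.erase i) k y) := by
      rw [← Finset.sum_add_distrib]
      refine Finset.sum_le_sum fun i hi => ?_
      have gx := Gam.erase hi hx
      have gy := Gam.erase hi hy
      obtain ⟨gz, hq⟩ := ih (S.erase i) x y gx gy
      have ax := gx k (by omega)
      have ay := gy k (by omega)
      have az := gz k (by omega)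
      refine sq_div_aux (div_pos px ax) (div_pos py ay) ?_
      rw [es_erase S k x i hi, es_erase S k y i hi, es_erase S k (x + y) i hi,
        add_div, add_div, add_div, mul_div_cancel_right₀ _ ax.ne',
        mul_div_cancel_right₀ _ ay.ne', mul_div_cancel_right₀ _ az.ne', Pi.add_apply]
      linarith
    have hs : ∑ i ∈ S, (x + y) i = ∑ i ∈ S, x i + ∑ i ∈ S, y i := by
      simp [Finset.sum_add_distrib]
    have hk : (0 : ℝ) < (k : ℝ) + 2 := by positivity
    have hfin : es S (k + 2) x / es S (k + 1) x + es S (k + 2) y / es S (k + 1) y ≤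
        es S (k + 2) (x + y) / es S (k + 1) (x + y) := by
      refine le_of_mul_le_mul_left ?_ hk
      rw [mul_add]
      linarith
    refine ⟨?_, hfin⟩
    intro j hj
    rcases Nat.lt_or_ge j (k + 2) with hlt | hge
    · exact hG j (by omega)
    obtain rfl : j = k + 2 := by omega
    have q1 := div_pos (hx (k + 2) (by omega)) px
    have q2 := div_pos (hy (k + 2) (by omega)) py
    exact (div_pos_iff_of_pos_right pz).1 (by linarith)

lemma es_prod {ι : Type*} (S : Finset ι) (k : ℕ) (x : ι → ℝ) (h : Gam S k x) :
    ∏ j ∈ Finset.range k, es S (j + 1) x / es S j x = es S k x := by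
  induction k with
  | zero => simp [es_zero]
  | succ k ih =>
    rw [Finset.prod_range_succ, ih (h.mono (by omega)), mul_div_cancel₀]
    exact (h k (by omega)).ne'

lemma geom_ratio (k : ℕ) (hk : 1 ≤ k) (A C : ℕ → ℝ) (hA : ∀ j ∈ range k, 0 < A j)
    (hC : ∀ j ∈ range k, 0 < C j) :
    (∏ j ∈ range k, A j) ^ ((1 : ℝ) / k) ≤
      (∏ j ∈ range k, C j) ^ ((1 : ℝ) / k) * ∑ j ∈ range k, (1 : ℝ) / k * (A j / C j) := by
  have hk0 : (k : ℝ) ≠ 0 := by positivity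
  have h := Real.geom_mean_le_arith_mean_weighted (range k) (fun _ => (1 : ℝ) / k)
    (fun j => A j / C j) (fun _ _ => by positivity)
    (by simp [hk0]) (fun j hj => (div_pos (hA j hj) (hC j hj)).le)
  rw [Real.finsetProd_rpow _ _ (fun j hj => (div_pos (hA j hj) (hC j hj)).le),
    Finset.prod_div_distrib, Real.div_rpow (Finset.prod_pos hA).le (Finset.prod_pos hC).le,
    div_le_iff₀ (Real.rpow_pos_of_pos (Finset.prod_pos hC) _)] at h
  linarith

lemma superadd {ι : Type*} [DecidableEq ι] (S : Finset ι) (k : ℕ) (hk : 1 ≤ k) (x y : ι → ℝ)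
    (hx : Gam S k x) (hy : Gam S k y) : Gam S k (x + y) ∧
    es S k x ^ ((1 : ℝ) / k) + es S k y ^ ((1 : ℝ) / k) ≤ es S k (x + y) ^ ((1 : ℝ) / k) := by
  have hz : Gam S k (x + y) := by
    obtain ⟨k, rfl⟩ := Nat.exists_eq_add_of_le' hk
    exact (main_step k S x y hx hy).1
  refine ⟨hz, ?_⟩
  have pos : ∀ z, Gam S k z → ∀ j ∈ range k, 0 < es S (j + 1) z / es S j z := by
    intro z hz j hj
    have := Finset.mem_range.1 hj
    exact div_pos (hz _ (by omega)) (hz _ (by omega))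
  have h1 := geom_ratio k hk _ _ (pos x hx) (pos _ hz)
  have h2 := geom_ratio k hk _ _ (pos y hy) (pos _ hz)
  rw [es_prod S k _ hx, es_prod S k _ hz] at h1
  rw [es_prod S k _ hy, es_prod S k _ hz] at h2
  refine (add_le_add h1 h2).trans ?_
  rw [← mul_add, ← Finset.sum_add_distrib]
  refine mul_le_of_le_one_right (Real.rpow_nonneg (hz k le_rfl).le _) ?_
  have hk0 : (k : ℝ) ≠ 0 := by positivity
  calc _ ≤ ∑ j ∈ range k, (1 : ℝ) / k := by
        refine Finset.sum_le_sum fun j hj => ?_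
        have := Finset.mem_range.1 hj
        rw [← mul_add, ← add_div]
        refine mul_le_of_le_one_right (by positivity) ?_
        rw [div_le_one (pos _ hz j hj)]
        exact (main_step j S x y (hx.mono (by omega)) (hy.mono (by omega))).2
    _ = 1 := by simp [hk0]

lemma es_smul {ι : Type*} (S : Finset ι) (k : ℕ) (a : ℝ) (x : ι → ℝ) :
    es S k (a • x) = a ^ k * es S k x := by
  unfold es
  rw [Finset.mul_sum]
  refine Finset.sum_congr rfl fun s hs => ?_
  simp only [Pi.smul_apply, smul_eq_mul, Finset.prod_mul_distrib, Finset.prod_const,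
    (Finset.mem_powersetCard.1 hs).2]

lemma Gam.smul {ι : Type*} {S : Finset ι} {k : ℕ} {a : ℝ} (ha : 0 < a) {x : ι → ℝ}
    (h : Gam S k x) : Gam S k (a • x) := fun j hj => by
  rw [es_smul]; exact mul_pos (pow_pos ha j) (h j hj)

lemma es_smul_rpow {ι : Type*} {S : Finset ι} {k : ℕ} (hk : 1 ≤ k) {a : ℝ} (ha : 0 < a)
    {x : ι → ℝ} (h : Gam S k x) :
    es S k (a • x) ^ ((1 : ℝ) / k) = a * es S k x ^ ((1 : ℝ) / k) := by
  rw [es_smul, Real.mul_rpow (by positivity) (h k le_rfl).le, one_div,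
    Real.pow_rpow_inv_natCast ha.le (by omega)]

lemma inGamma_iff (n k : ℕ) (x : Fin n → ℝ) : inGamma n k x ↔ Gam Finset.univ k x := by
  constructor
  · intro h j hj
    rcases Nat.eq_zero_or_pos j with rfl | hj0
    · rw [es_zero]; exact one_pos
    · exact h j hj0 hj
  · exact fun h j _ hj => h j hj

end GardingAux

/-- Garding's concavity: `λ ↦ σₖ(λ)^{1/k}` is concave on the cone `Γₖ⁺`. -/
theorem esymm_rpow_concave (n k : ℕ) (hk : 1 ≤ k) (hkn : k ≤ n) :
    ConcaveOn ℝ {lam : Fin n → ℝ | inGamma n k lam}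
      (fun lam => esymm n k lam ^ ((1 : ℝ) / k)) := by
  have key : ∀ x y : Fin n → ℝ, inGamma n k x → inGamma n k y → ∀ a b : ℝ, 0 < a → 0 < b →
      inGamma n k (a • x + b • y) ∧ a * esymm n k x ^ ((1 : ℝ) / k) +
        b * esymm n k y ^ ((1 : ℝ) / k) ≤ esymm n k (a • x + b • y) ^ ((1 : ℝ) / k) := by
    intro x y hx hy a b ha hb
    rw [GardingAux.inGamma_iff] at hx hy ⊢
    have h := GardingAux.superadd Finset.univ k hk _ _ (hx.smul ha) (hy.smul hb)
    rw [GardingAux.es_smul_rpow hk ha hx, GardingAux.es_smul_rpow hk hb hy] at h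
    exact h
  refine concaveOn_iff_forall_pos.2 ⟨?_, ?_⟩
  · exact convex_iff_forall_pos.2 fun x hx y hy a b ha hb _ => (key x y hx hy a b ha hb).1
  · exact fun x hx y hy a b ha hb _ => (key x y hx hy a b ha hb).2
end
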